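/- Let m ∈ ℝ. (1) For every a ∈ A^m(ℝⁿ×ℝⁿ;𝒜_θ) and u ∈ 𝒜_θ, the map (s,ξ) ↦ a(s,ξ) α_{−s}(u) belongs to A^m(ℝⁿ×ℝⁿ;𝒜_θ), and (a,u) ↦ a(s,ξ)α_{−s}(u) is a continuous bilinear map from A^m(ℝⁿ×ℝⁿ;𝒜_θ) × 𝒜_θ to A^m(ℝⁿ×ℝⁿ;𝒜_θ). (2) Consequently P_a u := J(a(s,ξ)α_{−s}(u)) is well defined and (a,u) ↦ P_a u is a continuous bilinear map from A^m(ℝⁿ×ℝⁿ;𝒜_θ) × 𝒜_θ to 𝒜_θ; in particular, for each a ∈ A^m(ℝⁿ×ℝⁿ;𝒜_θ) the operator P_a : 𝒜_θ → 𝒜_θ is a continuous linear operator. -/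

import Mathlib

open Complex Filter Topology
open scoped ComplexOrder Real BigOperators

noncomputable section

/-- Euclidean space `ℝⁿ`. -/
abbrev Rn (n : ℕ) : Type := EuclideanSpace ℝ (Fin n)

/-- `ℝⁿ × ℝⁿ`. -/
abbrev R2n (n : ℕ) : Type := Rn n × Rn n

/-- Length `|β|` of a multi-order `β ∈ ℕ₀ⁿ`. -/
def mdeg {n : ℕ} (b : Fin n → ℕ) : ℕ := ∑ j, b j

/-- Composition of a list of self-maps. -/
def compList {X : Type*} (l : List (X → X)) : X → X := l.foldr (· ∘ ·) id

/-- The phase `c(k,l) = Σ_{q<p} k_p θ_{pq} l_q`. -/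
def cPhase {n : ℕ} (θ : Matrix (Fin n) (Fin n) ℝ) (k l : Fin n → ℤ) : ℝ :=
  ∑ p, ∑ q, if q < p then (k p : ℝ) * θ p q * (l q : ℝ) else 0

/-- Euclidean norm `|k|` of a lattice point `k ∈ ℤⁿ`. -/
def znorm {n : ℕ} (k : Fin n → ℤ) : ℝ := Real.sqrt (∑ j, ((k j : ℝ)) ^ 2)

/-- `k^β = ∏ k_jᵝ`. -/
def kpow {n : ℕ} (b : Fin n → ℕ) (k : Fin n → ℤ) : ℝ := ∏ j, ((k j : ℝ)) ^ (b j)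

/-- A lattice point `k ∈ ℤⁿ` viewed as a point of `ℝⁿ`. -/
def zEmb {n : ℕ} (k : Fin n → ℤ) : Rn n := (WithLp.equiv 2 (Fin n → ℝ)).symm (fun j => (k j : ℝ))

variable {n : ℕ} {A : Type} [NormedRing A] [StarRing A] [CStarRing A]
  [NormedAlgebra ℂ A] [StarModule ℂ A] [CompleteSpace A]

/-- The derivation `δ_j u = (1/i) ∂_{s_j} α_s(u)|_{s=0}`. -/
def δd (αa : Rn n → (A ≃⋆ₐ[ℂ] A)) (j : Fin n) (u : A) : A :=
  (-Complex.I) • fderiv ℝ (fun s : Rn n => αa s u) 0 (EuclideanSpace.single j 1)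

/-- `δ^β = δ_1^{β_1} ⋯ δ_n^{β_n}`. -/
def δpow (αa : Rn n → (A ≃⋆ₐ[ℂ] A)) (b : Fin n → ℕ) : A → A :=
  compList (List.ofFn fun j => (δd αa j)^[b j])

/-- The smooth noncommutative torus `𝒜_θ`: elements with `C^∞` orbit map. -/
def SmoothSet (αa : Rn n → (A ≃⋆ₐ[ℂ] A)) : Set A :=
  {u | ∀ N : ℕ, ContDiff ℝ N (fun s : Rn n => αa s u)}

/-- `A_θ^{(N)}`: elements with `C^N` orbit map. -/
def CNSet (αa : Rn n → (A ≃⋆ₐ[ℂ] A)) (N : ℕ) : Set A :=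
  {u | ContDiff ℝ N (fun s : Rn n => αa s u)}

/-- The Fréchet seminorms `‖u‖_{(N)} = sup_{|β| ≤ N} ‖δ^β(u)‖` of `𝒜_θ`. -/
def frSemi (αa : Rn n → (A ≃⋆ₐ[ℂ] A)) (N : ℕ) (u : A) : ℝ :=
  ⨆ b : {b : Fin n → ℕ // mdeg b ≤ N}, ‖δpow αa b.1 u‖

/-- Partial derivative `∂_{ξ_j}` of maps `ℝⁿ → A`. -/
def pd {n : ℕ} (j : Fin n) (f : Rn n → A) : Rn n → A :=
  fun ξ => fderiv ℝ f ξ (EuclideanSpace.single j 1)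

/-- Iterated partial derivative `∂_ξ^β` of maps `ℝⁿ → A`. -/
def pdPow {n : ℕ} (b : Fin n → ℕ) : (Rn n → A) → (Rn n → A) :=
  compList (List.ofFn fun j => (pd j)^[b j])

/-- Partial derivative `∂_{s_j}` (first variable) of maps `ℝⁿ×ℝⁿ → A`. -/
def pdS {n : ℕ} (j : Fin n) (f : R2n n → A) : R2n n → A :=
  fun x => fderiv ℝ f x (EuclideanSpace.single j 1, 0)

/-- Partial derivative `∂_{ξ_j}` (second variable) of maps `ℝⁿ×ℝⁿ → A`. -/
def pdXi {n : ℕ} (j : Fin n) (f : R2n n → A) : R2n n → A :=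
  fun x => fderiv ℝ f x (0, EuclideanSpace.single j 1)

/-- `∂_s^β`. -/
def pdSPow {n : ℕ} (b : Fin n → ℕ) : (R2n n → A) → (R2n n → A) :=
  compList (List.ofFn fun j => (pdS j)^[b j])

/-- `∂_ξ^γ`. -/
def pdXiPow {n : ℕ} (b : Fin n → ℕ) : (R2n n → A) → (R2n n → A) :=
  compList (List.ofFn fun j => (pdXi j)^[b j])

/-- Forward difference operator `Δ_j` on maps `ℝⁿ → A`. -/
def fdiff {n : ℕ} (j : Fin n) (f : Rn n → A) : Rn n → A :=
  fun ξ => f (ξ + EuclideanSpace.single j 1) - f ξ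

/-- `Δ^β` on maps `ℝⁿ → A`. -/
def fdiffPow {n : ℕ} (b : Fin n → ℕ) : (Rn n → A) → (Rn n → A) :=
  compList (List.ofFn fun j => (fdiff j)^[b j])

/-- Forward difference operator `Δ_j` on sequences `ℤⁿ → A`. -/
def zdiff {n : ℕ} (j : Fin n) (f : (Fin n → ℤ) → A) : (Fin n → ℤ) → A :=
  fun k => f (k + Pi.single j 1) - f k

/-- `Δ^β` on sequences `ℤⁿ → A`. -/
def zdiffPow {n : ℕ} (b : Fin n → ℕ) : ((Fin n → ℤ) → A) → ((Fin n → ℤ) → A) :=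
  compList (List.ofFn fun j => (zdiff j)^[b j])

/-- The symbol class `𝕊^m(ℝⁿ; 𝒜_θ)`. -/
def IsSymbol (αa : Rn n → (A ≃⋆ₐ[ℂ] A)) (m : ℝ) (ρ : Rn n → A) : Prop :=
  (∀ ξ, ρ ξ ∈ SmoothSet αa) ∧
  (∀ a : Fin n → ℕ, ∀ N : ℕ, ContDiff ℝ N fun ξ => δpow αa a (ρ ξ)) ∧
  (∀ a b : Fin n → ℕ, ∃ C > 0, ∀ ξ,
    ‖δpow αa a (pdPow b ρ ξ)‖ ≤ C * (1 + ‖ξ‖) ^ (m - (mdeg b : ℝ)))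

/-- The class `𝒮(ℝⁿ; 𝒜_θ) = ∩ₘ 𝕊^m(ℝⁿ; 𝒜_θ)`. -/
def IsSchwartzSym (αa : Rn n → (A ≃⋆ₐ[ℂ] A)) (ρ : Rn n → A) : Prop :=
  ∀ m : ℝ, IsSymbol αa m ρ

/-- The seminorm `p_N^{(m)}` on `𝕊^m(ℝⁿ; 𝒜_θ)`. -/
def pSemi (αa : Rn n → (A ≃⋆ₐ[ℂ] A)) (m : ℝ) (N : ℕ) (ρ : Rn n → A) : ℝ :=
  ⨆ q : {ab : (Fin n → ℕ) × (Fin n → ℕ) // mdeg ab.1 + mdeg ab.2 ≤ N} × Rn n,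
    (1 + ‖q.2‖) ^ (-m + (mdeg q.1.1.2 : ℝ)) * ‖δpow αa q.1.1.1 (pdPow q.1.1.2 ρ q.2)‖

/-- The amplitude class `A^m(ℝⁿ×ℝⁿ; 𝒜_θ)`. -/
def IsAmplitude (αa : Rn n → (A ≃⋆ₐ[ℂ] A)) (m : ℝ) (a : R2n n → A) : Prop :=
  (∀ x, a x ∈ SmoothSet αa) ∧
  (∀ c : Fin n → ℕ, ∀ N : ℕ, ContDiff ℝ N fun x => δpow αa c (a x)) ∧
  (∀ c b g : Fin n → ℕ, ∃ C > 0, ∀ x : R2n n,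
    ‖δpow αa c (pdSPow b (pdXiPow g a) x)‖ ≤ C * (1 + ‖x.1‖ + ‖x.2‖) ^ m)

/-- The seminorm `q_N^{(m)}` on `A^m(ℝⁿ×ℝⁿ; 𝒜_θ)`. -/
def qSemi (αa : Rn n → (A ≃⋆ₐ[ℂ] A)) (m : ℝ) (N : ℕ) (a : R2n n → A) : ℝ :=
  ⨆ q : {t : (Fin n → ℕ) × (Fin n → ℕ) × (Fin n → ℕ) //
      mdeg t.1 + mdeg t.2.1 + mdeg t.2.2 ≤ N} × R2n n,
    (1 + ‖q.2.1‖ + ‖q.2.2‖) ^ (-m) *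
      ‖δpow αa q.1.1.1 (pdSPow q.1.1.2.1 (pdXiPow q.1.1.2.2 a) q.2)‖

/-- The toroidal symbol class `𝕊^m(ℤⁿ; 𝒜_θ)`. -/
def IsToroidal (αa : Rn n → (A ≃⋆ₐ[ℂ] A)) (m : ℝ) (ρ : (Fin n → ℤ) → A) : Prop :=
  (∀ k, ρ k ∈ SmoothSet αa) ∧
  (∀ a b : Fin n → ℕ, ∃ C > 0, ∀ k,
    ‖δpow αa a (zdiffPow b ρ k)‖ ≤ C * (1 + znorm k) ^ (m - (mdeg b : ℝ)))

/-- The coefficient `(1-χ)/(|s|²+|ξ|²)` of the operator `L`. -/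
def Lcoef {n : ℕ} (χc : R2n n → ℝ) (x : R2n n) : ℝ := (1 - χc x) / (‖x.1‖ ^ 2 + ‖x.2‖ ^ 2)

/-- The transpose `L^t` of `L = χ + (1-χ)(|s|²+|ξ|²)^{-1} Σ (ξ_j D_{s_j} + s_j D_{ξ_j})`,
namely `L^t u = χ u - Σ_j (D_{s_j}((1-χ)(|s|²+|ξ|²)^{-1} ξ_j u) + D_{ξ_j}(… s_j u))`. -/
def Ltrans (χc : R2n n → ℝ) (u : R2n n → A) : R2n n → A := fun x =>
  χc x • u x -
    ∑ j, ((-Complex.I) • pdS j (fun y => (Lcoef χc y * y.2 j) • u y) x +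
      (-Complex.I) • pdXi j (fun y => (Lcoef χc y * y.1 j) • u y) x)

/-- The (regularized) oscillating integral `(2π)^{-n} ∬ e^{is·ξ} (L^t)^N[a(s,ξ)] ds dξ`. -/
def Josc (χc : R2n n → ℝ) (N : ℕ) (a : R2n n → A) : A :=
  ((2 * Real.pi) ^ n)⁻¹ •
    MeasureTheory.integral MeasureTheory.volume
      (fun x : R2n n => Complex.exp (Complex.I * ((∑ j, x.1 j * x.2 j : ℝ) : ℂ)) •
        ((Ltrans χc)^[N] a) x)

/-- A convenient integer `> m + 2n`. -/
def Nfor (n : ℕ) (m : ℝ) : ℕ := ⌈m⌉₊ + 2 * n + 1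

section IsometricAction

open scoped ContDiff

set_option linter.unusedSectionVars false

/-- `αa` is an action of `ℝⁿ` by isometric automorphisms. -/
structure IsIsometricAction (αa : Rn n → (A ≃⋆ₐ[ℂ] A)) : Prop where
  add : ∀ s t (u : A), αa (s + t) u = αa s (αa t u)
  zero : ∀ u : A, αa 0 u = u
  norm_map : ∀ s (u : A), ‖αa s u‖ = ‖u‖

/-- The automorphism `αa s` as a continuous real-linear map. -/
def IsIsometricAction.toCLM {αa : Rn n → (A ≃⋆ₐ[ℂ] A)} (H : IsIsometricAction αa) (s : Rn n) :
    A →L[ℝ] A :=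
  LinearMap.mkContinuous
    { toFun := fun u => αa s u
      map_add' := fun u v => map_add _ u v
      map_smul' := fun c u => by
        simpa [Complex.coe_smul] using map_smul (αa s) (c : ℂ) u } 1
    (fun u => by simp [H.norm_map])

theorem IsIsometricAction.toCLM_apply {αa : Rn n → (A ≃⋆ₐ[ℂ] A)} (H : IsIsometricAction αa)
    (s : Rn n) (u : A) : H.toCLM s u = αa s u := rfl

/-- The index type of the operators `δ_j`, `∂_{s_j}`, `∂_{ξ_j}`. -/
abbrev DiffIndex (n : ℕ) : Type := Fin n ⊕ Fin n ⊕ Fin n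

/-- The scalar in front of the derivative defining one of the operators. -/
def diffCoef : DiffIndex n → ℂ
  | .inl _ => -Complex.I
  | .inr _ => 1

/-- The direction in which one of the operators differentiates. -/
def diffDir : DiffIndex n → Rn n × R2n n
  | .inl j => (EuclideanSpace.single j 1, 0)
  | .inr (.inl j) => (0, (EuclideanSpace.single j 1, 0))
  | .inr (.inr j) => (0, (0, EuclideanSpace.single j 1))

/-- The map `(s, x) ↦ α_s(f(x))`. -/
def orbitMap (αa : Rn n → (A ≃⋆ₐ[ℂ] A)) (f : R2n n → A) : Rn n × R2n n → A :=
  fun h => αa h.1 (f h.2)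

/-- Smoothness of `f` jointly with its orbits. -/
def JointSmooth (αa : Rn n → (A ≃⋆ₐ[ℂ] A)) (f : R2n n → A) : Prop :=
  ContDiff ℝ ∞ (orbitMap αa f)

/-- The operators `δ_j`, `∂_{s_j}`, `∂_{ξ_j}` on maps `ℝⁿ × ℝⁿ → A`. -/
def mixedD (αa : Rn n → (A ≃⋆ₐ[ℂ] A)) (d : DiffIndex n) (f : R2n n → A) : R2n n → A :=
  fun x => diffCoef d • fderiv ℝ (orbitMap αa f) (0, x) (diffDir d)

variable {αa : Rn n → (A ≃⋆ₐ[ℂ] A)} {f g : R2n n → A}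

theorem JointSmooth.differentiable (hf : JointSmooth αa f) : Differentiable ℝ (orbitMap αa f) :=
  ContDiff.differentiable hf (by simp)

theorem JointSmooth.contDiff (H : IsIsometricAction αa) (hf : JointSmooth αa f) :
    ContDiff ℝ ∞ f := by
  have h : ContDiff ℝ ∞ (fun x : R2n n => orbitMap αa f (0, x)) :=
    ContDiff.comp hf (contDiff_prodMk_right 0)
  simpa [orbitMap, H.zero] using h

theorem JointSmooth.mem_smoothSet (hf : JointSmooth αa f) (x : R2n n) : f x ∈ SmoothSet αa := by
  intro N
  have h : ContDiff ℝ ∞ (fun s : Rn n => orbitMap αa f (s, x)) :=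
    ContDiff.comp hf (contDiff_prodMk_left x)
  exact h.of_le (by exact_mod_cast le_top)

theorem jointSmooth_const {u : A} (hu : u ∈ SmoothSet αa) : JointSmooth αa (fun _ => u) := by
  have h : ContDiff ℝ ∞ (fun s : Rn n => αa s u) := contDiff_infty.2 hu
  exact h.comp contDiff_fst

theorem orbitMap_mixedD (H : IsIsometricAction αa) (hf : JointSmooth αa f) (d : DiffIndex n) :
    orbitMap αa (mixedD αa d f) =
      fun h => diffCoef d • fderiv ℝ (orbitMap αa f) h (diffDir d) := by
  ext ⟨s, x⟩
  have h1 : (fun h : Rn n × R2n n => orbitMap αa f ((s, 0) + h)) =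
      fun h => H.toCLM s (orbitMap αa f h) := by
    ext h
    simp [orbitMap, H.add, H.toCLM_apply]
  have h2 : fderiv ℝ (fun h : Rn n × R2n n => orbitMap αa f ((s, 0) + h)) (0, x) =
      fderiv ℝ (orbitMap αa f) (s, x) := by
    rw [fderiv_comp_add_left]
    simp
  have h3 : fderiv ℝ (fun h => H.toCLM s (orbitMap αa f h)) (0, x) =
      (H.toCLM s).comp (fderiv ℝ (orbitMap αa f) (0, x)) :=
    ((H.toCLM s).hasFDerivAt.comp _ (hf.differentiable _).hasFDerivAt).fderiv
  rw [h1, h3] at h2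
  simp only [← h2, orbitMap, mixedD, map_smul, ContinuousLinearMap.comp_apply, H.toCLM_apply]

theorem JointSmooth.mixedD (H : IsIsometricAction αa) (hf : JointSmooth αa f) (d : DiffIndex n) :
    JointSmooth αa (mixedD αa d f) := by
  unfold JointSmooth
  rw [orbitMap_mixedD H hf]
  exact (((contDiff_infty_iff_fderiv.1 hf).2).clm_apply contDiff_const).const_smul _

theorem mixedD_comm (H : IsIsometricAction αa) (hf : JointSmooth αa f) (d e : DiffIndex n) :
    mixedD αa d (mixedD αa e f) = mixedD αa e (mixedD αa d f) := by
  have key : ∀ d e : DiffIndex n, ∀ x, mixedD αa d (mixedD αa e f) x =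
      diffCoef d • diffCoef e •
        fderiv ℝ (fderiv ℝ (orbitMap αa f)) (0, x) (diffDir d) (diffDir e) := by
    intro d e x
    have h1 : HasFDerivAt (fderiv ℝ (orbitMap αa f))
        (fderiv ℝ (fderiv ℝ (orbitMap αa f)) (0, x)) (0, x) :=
      ((contDiff_infty_iff_fderiv.1 hf).2.differentiable (by simp) _).hasFDerivAt
    have h2 := ((ContinuousLinearMap.apply ℝ A (diffDir e)).hasFDerivAt.comp
      ((0 : Rn n), x) h1).const_smul (diffCoef e)
    rw [_root_.mixedD, orbitMap_mixedD H hf]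
    erw [h2.fderiv]
    simp
  ext x
  rw [key, key, smul_comm]
  have h : IsSymmSndFDerivAt ℝ (orbitMap αa f) (0, x) :=
    (contDiff_infty.1 hf 2).contDiffAt.isSymmSndFDerivAt (by simp)
  rw [h.eq]

theorem JointSmooth.mul (hf : JointSmooth αa f) (hg : JointSmooth αa g) :
    JointSmooth αa (fun x => f x * g x) := by
  have : orbitMap αa (fun x => f x * g x) = fun h => orbitMap αa f h * orbitMap αa g h := by
    ext h; simp [orbitMap]
  unfold JointSmooth
  rw [this]
  exact ContDiff.mul hf hg

theorem JointSmooth.add (hf : JointSmooth αa f) (hg : JointSmooth αa g) :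
    JointSmooth αa (fun x => f x + g x) := by
  have : orbitMap αa (fun x => f x + g x) = fun h => orbitMap αa f h + orbitMap αa g h := by
    ext h; simp [orbitMap]
  unfold JointSmooth
  rw [this]
  exact ContDiff.add hf hg

theorem JointSmooth.const_smul (hf : JointSmooth αa f) (c : ℂ) :
    JointSmooth αa (fun x => c • f x) := by
  have : orbitMap αa (fun x => c • f x) = fun h => c • orbitMap αa f h := by
    ext h; simp [orbitMap]
  unfold JointSmooth
  rw [this]
  exact ContDiff.const_smul c hf

theorem mixedD_mul (H : IsIsometricAction αa) (hf : JointSmooth αa f) (hg : JointSmooth αa g)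
    (d : DiffIndex n) :
    mixedD αa d (fun x => f x * g x) = fun x => mixedD αa d f x * g x + f x * mixedD αa d g x := by
  have : orbitMap αa (fun x => f x * g x) = fun h => orbitMap αa f h * orbitMap αa g h := by
    ext h; simp [orbitMap]
  ext x
  have h := (hf.differentiable (0, x)).hasFDerivAt.mul' (hg.differentiable (0, x)).hasFDerivAt
  simp only [mixedD, this]
  erw [h.fderiv]
  simp [orbitMap, H.zero, add_comm]

theorem mixedD_add (hf : JointSmooth αa f) (hg : JointSmooth αa g) (d : DiffIndex n) :
    mixedD αa d (fun x => f x + g x) = fun x => mixedD αa d f x + mixedD αa d g x := by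
  have : orbitMap αa (fun x => f x + g x) = fun h => orbitMap αa f h + orbitMap αa g h := by
    ext h; simp [orbitMap]
  ext x
  have h := (hf.differentiable (0, x)).hasFDerivAt.add (hg.differentiable (0, x)).hasFDerivAt
  simp only [mixedD, this]
  erw [h.fderiv]
  simp

theorem mixedD_const_smul (hf : JointSmooth αa f) (c : ℂ) (d : DiffIndex n) :
    mixedD αa d (fun x => c • f x) = fun x => c • mixedD αa d f x := by
  have : orbitMap αa (fun x => c • f x) = fun h => c • orbitMap αa f h := by
    ext h; simp [orbitMap]
  ext x
  have h := (hf.differentiable (0, x)).hasFDerivAt.const_smul c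
  simp only [mixedD, this]
  erw [h.fderiv]
  simp [smul_comm c]

theorem mixedD_inl (hf : JointSmooth αa f) (j : Fin n) (x : R2n n) :
    mixedD αa (.inl j) f x = δd αa j (f x) := by
  have h := (hf.differentiable (0, x)).hasFDerivAt.comp (f := fun s : Rn n => (s, x)) 0
    (hasFDerivAt_prodMk_left (𝕜 := ℝ) (0 : Rn n) x)
  have h' : fderiv ℝ (fun s : Rn n => αa s (f x)) 0 = _ := h.fderiv
  simp [mixedD, δd, h', diffCoef, diffDir]

theorem mixedD_inr (H : IsIsometricAction αa) (hf : JointSmooth αa f) (d : Fin n ⊕ Fin n)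
    (x : R2n n) : mixedD αa (.inr d) f x = fderiv ℝ f x (diffDir (.inr d)).2 := by
  have h := (hf.differentiable (0, x)).hasFDerivAt.comp x (hasFDerivAt_prodMk_right (0 : Rn n) x)
  have h0 : (orbitMap αa f ∘ fun y => ((0 : Rn n), y)) = f := by
    ext y; simp [orbitMap, H.zero]
  rw [h0] at h
  rcases d with j | j <;> simp [mixedD, h.fderiv, diffCoef, diffDir]

theorem mixedD_pdS (H : IsIsometricAction αa) (hf : JointSmooth αa f) (j : Fin n) :
    mixedD αa (.inr (.inl j)) f = pdS j f :=
  funext fun x => mixedD_inr H hf (.inl j) x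

theorem mixedD_pdXi (H : IsIsometricAction αa) (hf : JointSmooth αa f) (j : Fin n) :
    mixedD αa (.inr (.inr j)) f = pdXi j f :=
  funext fun x => mixedD_inr H hf (.inr j) x

section CompList

theorem compList_cons {X : Type*} (T : X → X) (l : List (X → X)) (x : X) :
    compList (T :: l) x = T (compList l x) := rfl

theorem compList_ofFn_succ {X : Type*} {k : ℕ} (T : Fin (k + 1) → X → X) (b : Fin (k + 1) → ℕ)
    (x : X) :
    compList (List.ofFn fun j => (T j)^[b j]) x =
      (T 0)^[b 0] (compList (List.ofFn fun j : Fin k => (T j.succ)^[b j.succ]) x) := by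
  rw [List.ofFn_succ, compList_cons]

theorem iterate_mem {X : Type*} {S : Set X} {T : X → X} (hT : ∀ x ∈ S, T x ∈ S) (N : ℕ) :
    ∀ x ∈ S, T^[N] x ∈ S := by
  induction N with
  | zero => exact fun x hx => hx
  | succ N ih => exact fun x hx => ih _ (hT x hx)

theorem compList_mem {X : Type*} {S : Set X} {k : ℕ} (T : Fin k → X → X)
    (hT : ∀ j, ∀ x ∈ S, T j x ∈ S) (b : Fin k → ℕ) :
    ∀ x ∈ S, compList (List.ofFn fun j => (T j)^[b j]) x ∈ S := by
  induction k with
  | zero => intro x hx; simpa [compList] using hx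
  | succ k ih =>
    intro x hx
    rw [compList_ofFn_succ]
    exact iterate_mem (hT 0) _ _ (ih _ (fun j => hT j.succ) _ x hx)

theorem iterate_comm_on {X : Type*} {S : Set X} {T R : X → X} (hT : ∀ x ∈ S, T x ∈ S)
    (hc : ∀ x ∈ S, R (T x) = T (R x)) (N : ℕ) : ∀ x ∈ S, R (T^[N] x) = T^[N] (R x) := by
  induction N with
  | zero => exact fun x hx => rfl
  | succ N ih =>
    intro x hx
    rw [Function.iterate_succ_apply, Function.iterate_succ_apply, ih _ (hT x hx), hc x hx]

theorem compList_comm_on {X : Type*} {S : Set X} {k : ℕ} (T : Fin k → X → X) (R : X → X)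
    (hT : ∀ j, ∀ x ∈ S, T j x ∈ S) (hc : ∀ j, ∀ x ∈ S, R (T j x) = T j (R x)) (b : Fin k → ℕ) :
    ∀ x ∈ S, R (compList (List.ofFn fun j => (T j)^[b j]) x) =
      compList (List.ofFn fun j => (T j)^[b j]) (R x) := by
  induction k with
  | zero => intro x hx; simp [compList]
  | succ k ih =>
    intro x hx
    rw [compList_ofFn_succ, compList_ofFn_succ,
      iterate_comm_on (hT 0) (hc 0) _ _ (compList_mem _ (fun j => hT j.succ) _ x hx),
      ih _ (fun j => hT j.succ) (fun j => hc j.succ) _ x hx]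

theorem compList_add_single {X : Type*} {S : Set X} {k : ℕ} (T : Fin k → X → X)
    (hT : ∀ j, ∀ x ∈ S, T j x ∈ S) (hc : ∀ i j, ∀ x ∈ S, T i (T j x) = T j (T i x))
    (b : Fin k → ℕ) (i : Fin k) :
    ∀ x ∈ S, T i (compList (List.ofFn fun j => (T j)^[b j]) x) =
      compList (List.ofFn fun j => (T j)^[(b + Pi.single i 1 : Fin k → ℕ) j]) x := by
  induction k with
  | zero => exact i.elim0
  | succ k ih =>
    intro x hx
    have hy := compList_mem _ (fun j : Fin k => hT j.succ) (fun j => b j.succ) x hx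
    rw [compList_ofFn_succ, compList_ofFn_succ]
    refine Fin.cases ?_ (fun i => ?_) i
    · have h : ∀ j : Fin k, (b + Pi.single 0 1 : Fin (k + 1) → ℕ) j.succ = b j.succ := by simp
      simp only [h]
      simp [← Function.iterate_succ_apply']
    · have h : ∀ j : Fin k, (b + Pi.single i.succ 1 : Fin (k + 1) → ℕ) j.succ =
          ((fun j : Fin k => b j.succ) + Pi.single i 1 : Fin k → ℕ) j := by
        intro j
        simp [Pi.single_apply]
      simp only [h]
      rw [← ih _ (fun j => hT j.succ) (fun i j => hc i.succ j.succ) (fun j => b j.succ) i x hx,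
        iterate_comm_on (hT 0) (hc i.succ 0) _ _ hy]
      simp

theorem mdeg_add_single {k : ℕ} (b : Fin k → ℕ) (i : Fin k) :
    mdeg (b + Pi.single i 1) = mdeg b + 1 := by
  simp [mdeg, Finset.sum_add_distrib]

theorem compList_congr_on {X : Type*} {S : Set X} {k : ℕ} (T T' : Fin k → X → X)
    (hT : ∀ j, ∀ x ∈ S, T j x ∈ S) (he : ∀ j, ∀ x ∈ S, T j x = T' j x) (b : Fin k → ℕ) :
    ∀ x ∈ S, compList (List.ofFn fun j => (T j)^[b j]) x =
      compList (List.ofFn fun j => (T' j)^[b j]) x := by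
  induction k with
  | zero => intro x hx; simp [compList]
  | succ k ih =>
    intro x hx
    have h : ∀ N, ∀ y ∈ S, (T 0)^[N] y = (T' 0)^[N] y := by
      intro N
      induction N with
      | zero => exact fun y hy => rfl
      | succ N ihN =>
        intro y hy
        rw [Function.iterate_succ_apply, Function.iterate_succ_apply, ihN _ (hT 0 y hy), he 0 y hy]
    rw [compList_ofFn_succ, compList_ofFn_succ,
      h _ _ (compList_mem _ (fun j => hT j.succ) _ x hx),
      ih _ _ (fun j => hT j.succ) (fun j => he j.succ) _ x hx]

theorem compList_semiconj_on {X Y : Type*} {S : Set X} {k : ℕ} (T : Fin k → X → X)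
    (T' : Fin k → Y → Y) (φ : X → Y) (hT : ∀ j, ∀ x ∈ S, T j x ∈ S)
    (he : ∀ j, ∀ x ∈ S, φ (T j x) = T' j (φ x)) (b : Fin k → ℕ) :
    ∀ x ∈ S, φ (compList (List.ofFn fun j => (T j)^[b j]) x) =
      compList (List.ofFn fun j => (T' j)^[b j]) (φ x) := by
  induction k with
  | zero => intro x hx; simp [compList]
  | succ k ih =>
    intro x hx
    have h : ∀ N, ∀ y ∈ S, φ ((T 0)^[N] y) = (T' 0)^[N] (φ y) := by
      intro N
      induction N with
      | zero => exact fun y hy => rfl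
      | succ N ihN =>
        intro y hy
        rw [Function.iterate_succ_apply, Function.iterate_succ_apply, ihN _ (hT 0 y hy), he 0 y hy]
    rw [compList_ofFn_succ, compList_ofFn_succ,
      h _ _ (compList_mem _ (fun j => hT j.succ) _ x hx),
      ih _ _ (fun j => hT j.succ) (fun j => he j.succ) _ x hx]

end CompList

/-- `δ^c ∂_s^b ∂_ξ^g`, written with the operators `mixedD`. -/
def mixedPow (αa : Rn n → (A ≃⋆ₐ[ℂ] A)) (c b g : Fin n → ℕ) (f : R2n n → A) : R2n n → A :=
  compList (List.ofFn fun j => (mixedD αa (.inl j))^[c j])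
    (compList (List.ofFn fun j => (mixedD αa (.inr (.inl j)))^[b j])
      (compList (List.ofFn fun j => (mixedD αa (.inr (.inr j)))^[g j]) f))

theorem δpow_apply (H : IsIsometricAction αa) (hf : JointSmooth αa f) (c : Fin n → ℕ)
    (x : R2n n) :
    compList (List.ofFn fun j => (mixedD αa (.inl j))^[c j]) f x = δpow αa c (f x) :=
  compList_semiconj_on (S := {f | JointSmooth αa f}) _ (δd αa) (fun f : R2n n → A => f x)
    (fun _ _ hf => JointSmooth.mixedD H hf _) (fun j _ hf => mixedD_inl hf j x) c f hf

theorem mixedPow_apply (H : IsIsometricAction αa) (hf : JointSmooth αa f) (c b g : Fin n → ℕ)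
    (x : R2n n) :
    mixedPow αa c b g f x = δpow αa c (pdSPow b (pdXiPow g f) x) := by
  have hS : ∀ d, ∀ f ∈ {f : R2n n → A | JointSmooth αa f}, mixedD αa d f ∈
      {f : R2n n → A | JointSmooth αa f} := fun d f hf => JointSmooth.mixedD H hf d
  have h1 := compList_mem _ (fun j => hS (.inr (.inr j))) g f hf
  have h2 := compList_mem _ (fun j => hS (.inr (.inl j))) b _ h1
  rw [mixedPow, δpow_apply H h2, pdSPow, pdXiPow,
    compList_congr_on _ _ (fun j => hS (.inr (.inl j))) (fun j f hf => mixedD_pdS H hf j) b _ h1,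
    compList_congr_on _ _ (fun j => hS (.inr (.inr j))) (fun j f hf => mixedD_pdXi H hf j) g _ hf]

theorem mixedD_mixedPow (H : IsIsometricAction αa) (hf : JointSmooth αa f) (c b g : Fin n → ℕ)
    (d : DiffIndex n) :
    ∃ c' b' g', mdeg c' + mdeg b' + mdeg g' = mdeg c + mdeg b + mdeg g + 1 ∧
      mixedD αa d (mixedPow αa c b g f) = mixedPow αa c' b' g' f := by
  have hS : ∀ d, ∀ f ∈ {f : R2n n → A | JointSmooth αa f}, mixedD αa d f ∈
      {f : R2n n → A | JointSmooth αa f} := fun d f hf => JointSmooth.mixedD H hf d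
  have hC : ∀ d e, ∀ f ∈ {f : R2n n → A | JointSmooth αa f},
      mixedD αa d (mixedD αa e f) = mixedD αa e (mixedD αa d f) :=
    fun d e f hf => mixedD_comm H hf d e
  have h1 := compList_mem _ (fun j => hS (.inr (.inr j))) g f hf
  have h2 := compList_mem _ (fun j => hS (.inr (.inl j))) b _ h1
  rcases d with j | j | j
  · refine ⟨c + Pi.single j 1, b, g, by rw [mdeg_add_single]; ring, ?_⟩
    exact compList_add_single _ (fun j => hS (.inl j)) (fun i j => hC _ _) c j _ h2
  · refine ⟨c, b + Pi.single j 1, g, by rw [mdeg_add_single]; ring, ?_⟩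
    rw [mixedPow, compList_comm_on _ _ (fun j => hS (.inl j)) (fun i => hC _ _) c _ h2, mixedPow,
      compList_add_single _ (fun j => hS (.inr (.inl j))) (fun i j => hC _ _) b j _ h1]
  · refine ⟨c, b, g + Pi.single j 1, by rw [mdeg_add_single]; ring, ?_⟩
    rw [mixedPow, compList_comm_on _ _ (fun j => hS (.inl j)) (fun i => hC _ _) c _ h2, mixedPow,
      compList_comm_on _ _ (fun j => hS (.inr (.inl j))) (fun i => hC _ _) b _ h1,
      compList_add_single _ (fun j => hS (.inr (.inr j))) (fun i j => hC _ _) g j _ hf]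

/-- All derivatives of `f` of order at most `N` are bounded by `K (1 + |s| + |ξ|)^m`. -/
def DerivBound (αa : Rn n → (A ≃⋆ₐ[ℂ] A)) (m : ℝ) : ℕ → ℝ → (R2n n → A) → Prop
  | 0, K, f => ∀ x, ‖f x‖ ≤ K * (1 + ‖x.1‖ + ‖x.2‖) ^ m
  | N + 1, K, f => (∀ x, ‖f x‖ ≤ K * (1 + ‖x.1‖ + ‖x.2‖) ^ m) ∧
      ∀ d, DerivBound αa m N K (mixedD αa d f)

theorem DerivBound.norm_le {m K : ℝ} {N : ℕ} (h : DerivBound αa m N K f) (x : R2n n) :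
    ‖f x‖ ≤ K * (1 + ‖x.1‖ + ‖x.2‖) ^ m := by
  cases N with
  | zero => exact h x
  | succ N => exact h.1 x

theorem DerivBound.of_succ {m K : ℝ} {N : ℕ} (h : DerivBound αa m (N + 1) K f) :
    DerivBound αa m N K f := by
  induction N generalizing f with
  | zero => exact h.1
  | succ N ih => exact ⟨h.1, fun d => ih (h.2 d)⟩

theorem DerivBound.of_le {m K : ℝ} {M N : ℕ} (hMN : M ≤ N) (h : DerivBound αa m N K f) :
    DerivBound αa m M K f := by
  induction hMN with
  | refl => exact h
  | step _ ih => exact ih h.of_succ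

theorem weight_pos (x : R2n n) : 0 < 1 + ‖x.1‖ + ‖x.2‖ := by positivity

theorem one_le_weight (x : R2n n) : 1 ≤ 1 + ‖x.1‖ + ‖x.2‖ := by
  have := norm_nonneg x.1
  have := norm_nonneg x.2
  linarith

theorem DerivBound.mono {m m' K K' : ℝ} {N : ℕ} (hm : m ≤ m') (hK : K ≤ K')
    (h : DerivBound αa m N K f) : DerivBound αa m' N K' f := by
  have key : ∀ f : R2n n → A, (∀ x, ‖f x‖ ≤ K * (1 + ‖x.1‖ + ‖x.2‖) ^ m) →
      ∀ x, ‖f x‖ ≤ K' * (1 + ‖x.1‖ + ‖x.2‖) ^ m' := by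
    intro f hf x
    have hp : 0 < (1 + ‖x.1‖ + ‖x.2‖) ^ m := Real.rpow_pos_of_pos (weight_pos x) _
    have hK0 : 0 ≤ K := by
      by_contra hneg
      have := hf x
      nlinarith [norm_nonneg (f x)]
    exact (hf x).trans (mul_le_mul hK (Real.rpow_le_rpow_of_exponent_le (one_le_weight x) hm)
      hp.le (hK0.trans hK))
  induction N generalizing f with
  | zero => exact key f h
  | succ N ih => exact ⟨key f h.1, fun d => ih (h.2 d)⟩

theorem DerivBound.nonneg {m K : ℝ} {N : ℕ} (h : DerivBound αa m N K f) : 0 ≤ K := by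
  have h0 := (norm_nonneg _).trans (h.norm_le 0)
  simpa using h0

theorem DerivBound.add {m K L : ℝ} {N : ℕ} (hf : JointSmooth αa f) (hg : JointSmooth αa g)
    (H : IsIsometricAction αa) (h : DerivBound αa m N K f) (h' : DerivBound αa m N L g) :
    DerivBound αa m N (K + L) (fun x => f x + g x) := by
  have key : ∀ x, ‖f x + g x‖ ≤ (K + L) * (1 + ‖x.1‖ + ‖x.2‖) ^ m := fun x =>
    (norm_add_le _ _).trans (by rw [add_mul]; exact add_le_add (h.norm_le x) (h'.norm_le x))
  induction N generalizing f g with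
  | zero => exact key
  | succ N ih =>
    refine ⟨key, fun d => ?_⟩
    rw [mixedD_add hf hg]
    exact ih (hf.mixedD H d) (hg.mixedD H d) (h.2 d) (h'.2 d)
      (fun x => (norm_add_le _ _).trans (by
        rw [add_mul]; exact add_le_add ((h.2 d).norm_le x) ((h'.2 d).norm_le x)))

theorem DerivBound.const_smul {m K : ℝ} {N : ℕ} (hf : JointSmooth αa f)
    (H : IsIsometricAction αa) (h : DerivBound αa m N K f) (c : ℂ) :
    DerivBound αa m N (‖c‖ * K) (fun x => c • f x) := by
  have key : ∀ f : R2n n → A, (∀ x, ‖f x‖ ≤ K * (1 + ‖x.1‖ + ‖x.2‖) ^ m) →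
      ∀ x, ‖c • f x‖ ≤ (‖c‖ * K) * (1 + ‖x.1‖ + ‖x.2‖) ^ m := fun f h x => by
    rw [norm_smul, mul_assoc]
    exact mul_le_mul_of_nonneg_left (h x) (norm_nonneg _)
  induction N generalizing f with
  | zero => exact key f h
  | succ N ih =>
    refine ⟨key f h.1, fun d => ?_⟩
    rw [mixedD_const_smul hf]
    exact ih (hf.mixedD H d) (h.2 d)

theorem DerivBound.mul {m μ K L : ℝ} {N : ℕ} (hf : JointSmooth αa f) (hg : JointSmooth αa g)
    (H : IsIsometricAction αa) (h : DerivBound αa m N K f) (h' : DerivBound αa μ N L g) :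
    DerivBound αa (m + μ) N (2 ^ N * (K * L)) (fun x => f x * g x) := by
  have hK := h.nonneg
  have hL := h'.nonneg
  have key : ∀ f g : R2n n → A, (∀ x, ‖f x‖ ≤ K * (1 + ‖x.1‖ + ‖x.2‖) ^ m) →
      (∀ x, ‖g x‖ ≤ L * (1 + ‖x.1‖ + ‖x.2‖) ^ μ) →
      ∀ x, ‖f x * g x‖ ≤ (K * L) * (1 + ‖x.1‖ + ‖x.2‖) ^ (m + μ) := fun f g h h' x => by
    rw [Real.rpow_add (weight_pos x), mul_mul_mul_comm]
    exact (norm_mul_le _ _).trans (mul_le_mul (h x) (h' x) (norm_nonneg _)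
      ((norm_nonneg _).trans (h x)))
  induction N generalizing f g with
  | zero => simpa [DerivBound] using key f g h h'
  | succ N ih =>
    constructor
    · intro x
      refine (key f g h.1 h'.1 x).trans (mul_le_mul_of_nonneg_right ?_
        (Real.rpow_nonneg (weight_pos x).le _))
      exact le_mul_of_one_le_left (mul_nonneg hK hL) (one_le_pow₀ (by norm_num))
    · intro d
      rw [mixedD_mul H hf hg]
      have h1 := ih (hf.mixedD H d) hg (h.2 d) h'.of_succ
      have h2 := ih hf (hg.mixedD H d) h.of_succ (h'.2 d)
      exact (h1.add ((hf.mixedD H d).mul hg) (hf.mul (hg.mixedD H d)) H h2).mono le_rfl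
        (by rw [pow_succ]; linarith)

theorem DerivBound.compList {m K : ℝ} {k : ℕ} (e : Fin k → DiffIndex n) (b : Fin k → ℕ) (N : ℕ)
    (h : DerivBound αa m (N + mdeg b) K f) :
    DerivBound αa m N K (compList (List.ofFn fun j => (mixedD αa (e j))^[b j]) f) := by
  induction k generalizing N with
  | zero => simpa [_root_.compList, mdeg] using h
  | succ k ih =>
    rw [compList_ofFn_succ]
    have hit : ∀ (M N : ℕ) (f : R2n n → A), DerivBound αa m (N + M) K f →
        DerivBound αa m N K ((mixedD αa (e 0))^[M] f) := by
      intro M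
      induction M with
      | zero => exact fun N f h => h
      | succ M ihM => exact fun N f h => ihM N _ (h.2 _)
    refine hit _ _ _ (ih (fun j => e j.succ) (fun j => b j.succ) _ ?_)
    rwa [mdeg, Fin.sum_univ_succ, ← add_assoc] at h

theorem DerivBound.mixedPow {m K : ℝ} {c b g : Fin n → ℕ} {N : ℕ}
    (h : DerivBound αa m (N + (mdeg c + mdeg b + mdeg g)) K f) :
    DerivBound αa m N K (mixedPow αa c b g f) := by
  refine DerivBound.compList (fun j => .inl j) c N (DerivBound.compList (fun j => .inr (.inl j)) b _
    (DerivBound.compList (fun j => .inr (.inr j)) g _ ?_))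
  simpa [add_assoc] using h

theorem derivBound_of_mixedPow {m K : ℝ} (H : IsIsometricAction αa) (hf : JointSmooth αa f)
    (N : ℕ) (h : ∀ c b g : Fin n → ℕ, mdeg c + mdeg b + mdeg g ≤ N → ∀ x,
      ‖mixedPow αa c b g f x‖ ≤ K * (1 + ‖x.1‖ + ‖x.2‖) ^ m) : DerivBound αa m N K f := by
  have key : ∀ (M : ℕ) (c b g : Fin n → ℕ), mdeg c + mdeg b + mdeg g + M ≤ N →
      DerivBound αa m M K (mixedPow αa c b g f) := by
    intro M
    induction M with
    | zero => exact fun c b g hN => h c b g hN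
    | succ M ih =>
      intro c b g hN
      refine ⟨h c b g (by omega), fun d => ?_⟩
      obtain ⟨c', b', g', hdeg, heq⟩ := mixedD_mixedPow H hf c b g d
      rw [heq]
      exact ih _ _ _ (by omega)
  have h0 : _root_.mixedPow αa 0 0 0 f = f := by
    have : ∀ (k : ℕ) (T : Fin k → (R2n n → A) → (R2n n → A)) (f : R2n n → A),
        compList (List.ofFn fun j => (T j)^[(0 : Fin k → ℕ) j]) f = f := by
      intro k T f
      induction k with
      | zero => simp [_root_.compList]
      | succ k ih => rw [compList_ofFn_succ]; exact ih _
    simp only [_root_.mixedPow, this]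
  simpa [h0] using key N 0 0 0 (by simp [mdeg])

/-- The linear map `v ↦ ∑ⱼ i vⱼ wⱼ`. -/
def orbitDeriv (w : Fin n → A) : Rn n →L[ℝ] A :=
  ∑ j, (EuclideanSpace.proj j : Rn n →L[ℝ] ℝ).smulRight (Complex.I • w j)

theorem orbitDeriv_apply (w : Fin n → A) (v : Rn n) :
    orbitDeriv w v = ∑ j, v j • Complex.I • w j := by
  simp [orbitDeriv]

theorem orbitDeriv_single (w : Fin n → A) (j : Fin n) :
    orbitDeriv w (EuclideanSpace.single j 1) = Complex.I • w j := by
  rw [orbitDeriv_apply, Finset.sum_eq_single j]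
  · simp
  · intro i _ hij
    simp [hij]
  · simp

theorem norm_orbitDeriv_le (w : Fin n → A) : ‖orbitDeriv w‖ ≤ ∑ j, ‖w j‖ := by
  refine ContinuousLinearMap.opNorm_le_bound _ (Finset.sum_nonneg fun j _ => norm_nonneg _) ?_
  intro v
  rw [orbitDeriv_apply, Finset.sum_mul]
  refine (norm_sum_le _ _).trans (Finset.sum_le_sum fun j _ => ?_)
  rw [norm_smul, norm_smul, Complex.norm_I, one_mul, mul_comm]
  exact mul_le_mul_of_nonneg_left (PiLp.norm_apply_le v j) (norm_nonneg _)

theorem contDiff_orbitDeriv {E : Type*} [NormedAddCommGroup E] [NormedSpace ℝ E]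
    [FiniteDimensional ℝ E] {N : WithTop ℕ∞}
    {w : Fin n → E → A} (h : ∀ j, ContDiff ℝ N (w j)) :
    ContDiff ℝ N (fun s => orbitDeriv (fun j => w j s)) := by
  simp only [orbitDeriv]
  exact ContDiff.sum fun j _ => contDiff_const.smulRight ((h j).const_smul _)

theorem mixedD_const {u : A} (hu : u ∈ SmoothSet αa) (j : Fin n) :
    mixedD αa (.inl j) (fun _ : R2n n => u) = fun _ => δd αa j u :=
  funext fun x => mixedD_inl (jointSmooth_const hu) j x

theorem δd_mem (H : IsIsometricAction αa) {u : A} (hu : u ∈ SmoothSet αa) (j : Fin n) :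
    δd αa j u ∈ SmoothSet αa := by
  have h := (jointSmooth_const hu).mixedD H (.inl j)
  rw [mixedD_const hu] at h
  exact h.mem_smoothSet 0

theorem δd_comm (H : IsIsometricAction αa) {u : A} (hu : u ∈ SmoothSet αa) (i j : Fin n) :
    δd αa i (δd αa j u) = δd αa j (δd αa i u) := by
  have h := mixedD_comm H (jointSmooth_const hu) (.inl i) (.inl j)
  rw [mixedD_const hu, mixedD_const hu, mixedD_const (δd_mem H hu j),
    mixedD_const (δd_mem H hu i)] at h
  exact congrFun h 0

theorem δpow_δd (H : IsIsometricAction αa) {u : A} (hu : u ∈ SmoothSet αa) (c : Fin n → ℕ)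
    (j : Fin n) : δpow αa c (δd αa j u) = δpow αa (c + Pi.single j 1) u := by
  have h1 := compList_comm_on (S := SmoothSet αa) (δd αa) (δd αa j)
    (fun i u hu => δd_mem H hu i) (fun i u hu => δd_comm H hu j i) c u hu
  have h2 := compList_add_single (S := SmoothSet αa) (δd αa)
    (fun i u hu => δd_mem H hu i) (fun i j u hu => δd_comm H hu i j) c j u hu
  exact h1.symm.trans h2

theorem δpow_zero (u : A) : δpow αa 0 u = u := by
  have : ∀ (k : ℕ) (T : Fin k → A → A),
      compList (List.ofFn fun j => (T j)^[(0 : Fin k → ℕ) j]) u = u := by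
    intro k T
    induction k with
    | zero => simp [compList]
    | succ k ih => rw [compList_ofFn_succ]; exact ih _
  exact this _ _

theorem hasFDerivAt_orbit (H : IsIsometricAction αa) {u : A} (hu : u ∈ SmoothSet αa) (s : Rn n) :
    HasFDerivAt (fun s => αa s u) (orbitDeriv fun j => αa s (δd αa j u)) s := by
  have hc := jointSmooth_const hu
  have hd : HasFDerivAt (fun s => αa s u)
      ((fderiv ℝ (orbitMap αa fun _ : R2n n => u) (s, 0)).comp
        (ContinuousLinearMap.inl ℝ (Rn n) (R2n n))) s :=
    (hc.differentiable (s, 0)).hasFDerivAt.comp (f := fun s : Rn n => (s, (0 : R2n n))) s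
      (hasFDerivAt_prodMk_left (𝕜 := ℝ) s 0)
  convert hd using 1
  refine ContinuousLinearMap.ext fun v => ?_
  have hv : v = ∑ j, v j • (EuclideanSpace.single j 1 : Rn n) := by
    ext i
    simp [Finset.sum_apply, Pi.single_apply]
  conv_rhs => rw [hv]
  rw [orbitDeriv_apply, map_sum]
  refine Finset.sum_congr rfl fun j _ => ?_
  rw [map_smul]
  congr 1
  have h := congrFun (orbitMap_mixedD H hc (.inl j)) (s, 0)
  rw [mixedD_const hu] at h
  simp only [orbitMap, diffCoef, diffDir] at h
  rw [h, smul_smul]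
  simp

theorem continuous_orbit {u : A} (hu : u ∈ SmoothSet αa) :
    Continuous (fun s : Rn n => αa s u) := (hu 0).continuous

/-- Maps with values in the smooth elements all of whose `δ`-derivatives are smooth. -/
structure PointwiseSmooth (αa : Rn n → (A ≃⋆ₐ[ℂ] A)) (f : R2n n → A) : Prop where
  mem : ∀ x, f x ∈ SmoothSet αa
  contDiff : ∀ (c : Fin n → ℕ) (N : ℕ), ContDiff ℝ N fun x => δpow αa c (f x)

theorem PointwiseSmooth.differentiable (hf : PointwiseSmooth αa f) : Differentiable ℝ f := by
  have h := hf.contDiff 0 1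
  simp only [δpow_zero] at h
  exact h.differentiable (by simp)

theorem PointwiseSmooth.δd (H : IsIsometricAction αa) (hf : PointwiseSmooth αa f) (j : Fin n) :
    PointwiseSmooth αa (fun x => δd αa j (f x)) where
  mem x := δd_mem H (hf.mem x) j
  contDiff c N := by
    simp only [δpow_δd H (hf.mem _)]
    exact hf.contDiff _ _

theorem tendstoUniformly_orbit (H : IsIsometricAction αa) {ι : Type*} {l : Filter ι} {w : ι → A}
    {u : A} (hw : Tendsto w l (𝓝 u)) :
    TendstoUniformly (fun i (s : Rn n) => αa s (w i)) (fun s => αa s u) l := by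
  rw [Metric.tendstoUniformly_iff]
  intro ε hε
  filter_upwards [Metric.tendsto_nhds.1 hw ε hε] with i hi s
  rwa [dist_eq_norm, ← map_sub, H.norm_map, ← dist_eq_norm, dist_comm]

theorem PointwiseSmooth.tendsto_slope (hf : PointwiseSmooth αa f) (x v : R2n n) :
    Tendsto (fun t : ℝ => t⁻¹ • (f (x + t • v) - f x)) (𝓝[≠] 0) (𝓝 (fderiv ℝ f x v)) :=
  ((hf.differentiable x).hasFDerivAt.hasLineDerivAt v).tendsto_slope_zero

theorem PointwiseSmooth.hasFDerivAt_orbit_fderiv (H : IsIsometricAction αa)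
    (hf : PointwiseSmooth αa f) (x v : R2n n) (s : Rn n) :
    HasFDerivAt (fun s => αa s (fderiv ℝ f x v))
      (orbitDeriv fun j => αa s (fderiv ℝ (fun y => _root_.δd αa j (f y)) x v)) s := by
  have hlim : Tendsto (fun t : ℝ => ∑ j : Fin n,
      ‖fderiv ℝ (fun y => _root_.δd αa j (f y)) x v -
        t⁻¹ • (_root_.δd αa j (f (x + t • v)) - _root_.δd αa j (f x))‖) (𝓝[≠] 0) (𝓝 0) := by
    rw [← Finset.sum_const_zero (s := (Finset.univ : Finset (Fin n)))]
    refine tendsto_finsetSum _ fun j _ => ?_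
    have h := ((hf.δd H j).tendsto_slope x v).const_sub
      (fderiv ℝ (fun y => _root_.δd αa j (f y)) x v)
    simpa using h.norm
  refine hasFDerivAt_of_tendstoUniformly (l := 𝓝[≠] (0 : ℝ))
    (f := fun (t : ℝ) s => αa s (t⁻¹ • (f (x + t • v) - f x)))
    (f' := fun (t : ℝ) s => orbitDeriv fun j =>
      αa s (t⁻¹ • (_root_.δd αa j (f (x + t • v)) - _root_.δd αa j (f x))))
    (g' := fun s => orbitDeriv fun j => αa s (fderiv ℝ (fun y => _root_.δd αa j (f y)) x v))
    ?_ ?_ ?_ s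
  · rw [Metric.tendstoUniformly_iff]
    intro ε hε
    filter_upwards [hlim.eventually_lt_const hε] with t ht s
    rw [dist_eq_norm]
    refine lt_of_le_of_lt ?_ ht
    have : ∀ w w' : Fin n → A, orbitDeriv w - orbitDeriv w' =
        orbitDeriv fun j => w j - w' j := by
      intro w w'
      ext v
      simp [orbitDeriv_apply, smul_sub]
    rw [this]
    refine (norm_orbitDeriv_le _).trans (Finset.sum_le_sum fun j _ => ?_)
    rw [← map_sub, H.norm_map]
  · intro t s
    have h := ((hasFDerivAt_orbit H (hf.mem (x + t • v)) s).sub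
      (hasFDerivAt_orbit H (hf.mem x) s)).const_smul t⁻¹
    have hR : ∀ s (r : ℝ) (u : A), αa s (r • u) = r • αa s u := fun s r u =>
      (H.toCLM s).map_smul r u
    convert h using 1
    · ext s
      simp [hR]
    · ext v
      simp only [hR, map_sub, orbitDeriv_apply, smul_apply,
        sub_apply, ← Finset.sum_sub_distrib, Finset.smul_sum, ← smul_sub]
      refine Finset.sum_congr rfl fun j _ => ?_
      rw [smul_comm Complex.I t⁻¹, smul_comm (v j) t⁻¹]
  · intro s
    exact (tendstoUniformly_orbit H (hf.tendsto_slope x v)).tendsto_at s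

theorem PointwiseSmooth.fderiv_mem (H : IsIsometricAction αa) (hf : PointwiseSmooth αa f)
    (x v : R2n n) : _root_.fderiv ℝ f x v ∈ SmoothSet αa := by
  intro N
  induction N generalizing f with
  | zero =>
    refine contDiff_zero.2 ((tendstoUniformly_orbit H (hf.tendsto_slope x v)).continuous
      (Frequently.of_forall fun t => ?_))
    have h := ((continuous_orbit (hf.mem (x + t • v))).sub
      (continuous_orbit (hf.mem x))).const_smul t⁻¹
    convert h using 2 with s
    exact ((H.toCLM s).map_smul _ _).trans (congrArg _ ((H.toCLM s).map_sub _ _))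
  | succ N ih =>
    exact contDiff_succ_iff_hasFDerivAt.2 ⟨_, contDiff_orbitDeriv fun j => ih (hf.δd H j),
      fun s => hf.hasFDerivAt_orbit_fderiv H x v s⟩

theorem PointwiseSmooth.δd_fderiv (H : IsIsometricAction αa) (hf : PointwiseSmooth αa f)
    (x v : R2n n) (j : Fin n) :
    _root_.δd αa j (fderiv ℝ f x v) = fderiv ℝ (fun y => _root_.δd αa j (f y)) x v := by
  rw [_root_.δd, (hf.hasFDerivAt_orbit_fderiv H x v 0).fderiv, orbitDeriv_single, H.zero, smul_smul]
  simp

theorem PointwiseSmooth.fderiv (H : IsIsometricAction αa) (hf : PointwiseSmooth αa f)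
    (v : R2n n) : PointwiseSmooth αa (fun x => fderiv ℝ f x v) where
  mem x := hf.fderiv_mem H x v
  contDiff c N := by
    let T : Fin n → (R2n n → A) → (R2n n → A) := fun j f x => _root_.δd αa j (f x)
    have hT : ∀ j, ∀ f ∈ {f | PointwiseSmooth αa f}, T j f ∈ {f | PointwiseSmooth αa f} :=
      fun j f hf => PointwiseSmooth.δd H hf j
    have h1 : compList (List.ofFn fun j => (T j)^[c j]) f = fun x => δpow αa c (f x) :=
      funext fun x => compList_semiconj_on T (_root_.δd αa) (fun f => f x) hT
        (fun _ _ _ => rfl) c f hf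
    have h2 : ∀ x, _root_.fderiv ℝ (fun x => δpow αa c (f x)) x v =
        δpow αa c (_root_.fderiv ℝ f x v) := fun x => by
      rw [← h1]
      exact compList_semiconj_on T (_root_.δd αa) (fun f => _root_.fderiv ℝ f x v) hT
        (fun j f hf => (PointwiseSmooth.δd_fderiv H hf x v j).symm) c f hf
    simp only [← h2]
    exact ((hf.contDiff c (N + 1)).fderiv_right le_rfl).clm_apply contDiff_const

theorem PointwiseSmooth.continuous_orbitMap (H : IsIsometricAction αa)
    (hf : PointwiseSmooth αa f) : Continuous (orbitMap αa f) := by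
  rw [continuous_iff_continuousAt]
  rintro ⟨s₀, x₀⟩
  rw [ContinuousAt, tendsto_iff_norm_sub_tendsto_zero]
  have h1 : Tendsto (fun h : Rn n × R2n n => ‖f h.2 - f x₀‖ + ‖αa h.1 (f x₀) - αa s₀ (f x₀)‖)
      (𝓝 (s₀, x₀)) (𝓝 0) := by
    have hc : Continuous (fun h : Rn n × R2n n =>
        ‖f h.2 - f x₀‖ + ‖αa h.1 (f x₀) - αa s₀ (f x₀)‖) :=
      (((hf.differentiable.continuous.comp continuous_snd).sub continuous_const).norm).add
        ((((continuous_orbit (hf.mem x₀)).comp continuous_fst).sub continuous_const).norm)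
    simpa using hc.tendsto (s₀, x₀)
  refine squeeze_zero (fun _ => norm_nonneg _) (fun h => ?_) h1
  rw [← H.norm_map h.1 (f h.2 - f x₀), map_sub]
  simpa [orbitMap] using norm_sub_le_norm_sub_add_norm_sub (αa h.1 (f h.2)) (αa h.1 (f x₀))
    (αa s₀ (f x₀))

theorem PointwiseSmooth.jointSmooth (H : IsIsometricAction αa) (hf : PointwiseSmooth αa f) :
    JointSmooth αa f := by
  refine contDiff_infty.2 fun N => ?_
  induction N generalizing f with
  | zero => exact contDiff_zero.2 (hf.continuous_orbitMap H)
  | succ N ih =>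
    let f₁ : Rn n → R2n n → Rn n →L[ℝ] A := fun s x =>
      orbitDeriv fun j => αa s (_root_.δd αa j (f x))
    let f₂ : Rn n → R2n n → R2n n →L[ℝ] A := fun s x => (H.toCLM s).comp (_root_.fderiv ℝ f x)
    have h₁ : ContDiff ℝ N (Function.uncurry f₁) := contDiff_orbitDeriv fun j => ih (hf.δd H j)
    have h₂ : ContDiff ℝ N (Function.uncurry f₂) := contDiff_clm_apply_iff.2 fun v =>
      ih (hf.fderiv H v)
    refine contDiff_succ_iff_hasFDerivAt.2
      ⟨fun h => (Function.uncurry f₁ h).coprod (Function.uncurry f₂ h), ?_, fun h => ?_⟩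
    · refine contDiff_clm_apply_iff.2 fun v => ?_
      simp only [ContinuousLinearMap.coprod_apply]
      exact (h₁.clm_apply contDiff_const).add (h₂.clm_apply contDiff_const)
    · refine (hasStrictFDerivAt_uncurry_coprod (f := fun s x => αa s (f x)) (f₁ := f₁) (f₂ := f₂)
        (Eventually.of_forall fun v => hasFDerivAt_orbit H (hf.mem v.2) v.1)
        (Eventually.of_forall fun v => (H.toCLM v.1).hasFDerivAt.comp v.2
          (hf.differentiable v.2).hasFDerivAt)
        h₁.continuous.continuousAt h₂.continuous.continuousAt).hasFDerivAt

theorem IsAmplitude.jointSmooth (H : IsIsometricAction αa) {m : ℝ} (hf : IsAmplitude αa m f) :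
    JointSmooth αa f :=
  PointwiseSmooth.jointSmooth H ⟨hf.1, hf.2.1⟩

theorem IsAmplitude.bddAbove_qSemi {m : ℝ} (hf : IsAmplitude αa m f) (N : ℕ) :
    BddAbove (Set.range fun q : {t : (Fin n → ℕ) × (Fin n → ℕ) × (Fin n → ℕ) //
      mdeg t.1 + mdeg t.2.1 + mdeg t.2.2 ≤ N} × R2n n =>
      (1 + ‖q.2.1‖ + ‖q.2.2‖) ^ (-m) *
        ‖δpow αa q.1.1.1 (pdSPow q.1.1.2.1 (pdXiPow q.1.1.2.2 f) q.2)‖) := by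
  have hfin : Finite {t : (Fin n → ℕ) × (Fin n → ℕ) × (Fin n → ℕ) //
      mdeg t.1 + mdeg t.2.1 + mdeg t.2.2 ≤ N} := by
    refine Set.Finite.subset ((Set.finite_Iic (fun _ => N)).prod
      ((Set.finite_Iic (fun _ => N)).prod (Set.finite_Iic (fun _ => N)))) ?_
    rintro ⟨c, b, g⟩ h
    have hle : ∀ (b : Fin n → ℕ) (j : Fin n), b j ≤ mdeg b := fun b j =>
      Finset.single_le_sum (f := b) (fun _ _ => Nat.zero_le _) (Finset.mem_univ j)
    replace h : mdeg c + mdeg b + mdeg g ≤ N := h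
    refine ⟨fun j => ?_, fun j => ?_, fun j => ?_⟩
    · have := hle c j
      change c j ≤ N
      omega
    · have := hle b j
      change b j ≤ N
      omega
    · have := hle g j
      change g j ≤ N
      omega
  choose C hC0 hC using hf.2.2
  have := Fintype.ofFinite {t : (Fin n → ℕ) × (Fin n → ℕ) × (Fin n → ℕ) //
      mdeg t.1 + mdeg t.2.1 + mdeg t.2.2 ≤ N}
  refine ⟨∑ t : {t : (Fin n → ℕ) × (Fin n → ℕ) × (Fin n → ℕ) //
      mdeg t.1 + mdeg t.2.1 + mdeg t.2.2 ≤ N}, C t.1.1 t.1.2.1 t.1.2.2, ?_⟩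
  rintro _ ⟨⟨t, x⟩, rfl⟩
  refine le_trans ?_ (Finset.single_le_sum
    (f := fun t : {t : (Fin n → ℕ) × (Fin n → ℕ) × (Fin n → ℕ) //
      mdeg t.1 + mdeg t.2.1 + mdeg t.2.2 ≤ N} => C t.1.1 t.1.2.1 t.1.2.2)
    (fun t _ => (hC0 _ _ _).le) (Finset.mem_univ t))
  dsimp only
  rw [Real.rpow_neg (weight_pos x).le, inv_mul_le_iff₀ (Real.rpow_pos_of_pos (weight_pos x) _),
    mul_comm]
  exact hC _ _ _ _

theorem IsAmplitude.derivBound (H : IsIsometricAction αa) {m : ℝ} (hf : IsAmplitude αa m f)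
    (N : ℕ) : DerivBound αa m N (qSemi αa m N f) f := by
  refine derivBound_of_mixedPow H (hf.jointSmooth H) N fun c b g h x => ?_
  rw [mixedPow_apply H (hf.jointSmooth H)]
  have h := le_ciSup (hf.bddAbove_qSemi N) (⟨(c, b, g), h⟩, x)
  dsimp only at h
  rwa [Real.rpow_neg (weight_pos x).le, inv_mul_le_iff₀ (Real.rpow_pos_of_pos (weight_pos x) _),
    mul_comm] at h

theorem DerivBound.norm_mixedPow_le (H : IsIsometricAction αa) (hf : JointSmooth αa f)
    {m K : ℝ} {N : ℕ} (h : DerivBound αa m N K f) {c b g : Fin n → ℕ}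
    (hN : mdeg c + mdeg b + mdeg g ≤ N) (x : R2n n) :
    ‖δpow αa c (pdSPow b (pdXiPow g f) x)‖ ≤ K * (1 + ‖x.1‖ + ‖x.2‖) ^ m := by
  rw [← mixedPow_apply H hf]
  exact (DerivBound.mixedPow (N := 0) (by simpa using h.of_le hN)).norm_le x

theorem DerivBound.qSemi_le (H : IsIsometricAction αa) (hf : JointSmooth αa f)
    {m K : ℝ} {N : ℕ} (h : DerivBound αa m N K f) : qSemi αa m N f ≤ K := by
  refine Real.iSup_le (fun q => ?_) h.nonneg
  rw [Real.rpow_neg (weight_pos q.2).le,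
    inv_mul_le_iff₀ (Real.rpow_pos_of_pos (weight_pos q.2) _), mul_comm]
  exact h.norm_mixedPow_le H hf q.1.2 q.2

theorem JointSmooth.isAmplitude (H : IsIsometricAction αa) (hf : JointSmooth αa f) {m : ℝ}
    (h : ∀ N, ∃ K, DerivBound αa m N K f) : IsAmplitude αa m f := by
  refine ⟨hf.mem_smoothSet, fun c N => ?_, fun c b g => ?_⟩
  · have hc := compList_mem (S := {f | JointSmooth αa f}) _
      (fun (j : Fin n) f hf => JointSmooth.mixedD H hf (.inl j)) c f hf
    simp only [← δpow_apply H hf]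
    exact contDiff_infty.1 (JointSmooth.contDiff H hc) N
  · obtain ⟨K, hK⟩ := h (mdeg c + mdeg b + mdeg g)
    refine ⟨K + 1, by linarith [hK.nonneg], fun x => ?_⟩
    exact (hK.mono le_rfl (by linarith : K ≤ K + 1)).norm_mixedPow_le H hf le_rfl x

theorem norm_δpow_le_frSemi (u : A) {N : ℕ} {c : Fin n → ℕ} (hc : mdeg c ≤ N) :
    ‖δpow αa c u‖ ≤ frSemi αa N u := by
  have hfin : Finite {b : Fin n → ℕ // mdeg b ≤ N} := by
    refine Set.Finite.subset (Set.finite_Iic (fun _ => N)) fun b hb j => ?_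
    exact (Finset.single_le_sum (f := b) (fun _ _ => Nat.zero_le _) (Finset.mem_univ j)).trans hb
  exact le_ciSup (f := fun b : {b : Fin n → ℕ // mdeg b ≤ N} => ‖δpow αa b.1 u‖)
    (Set.finite_range _).bddAbove ⟨c, hc⟩

/-- The map `(s, ξ) ↦ α_{-s}(u)`. -/
def shiftMap (αa : Rn n → (A ≃⋆ₐ[ℂ] A)) (u : A) : R2n n → A := fun x => αa (-x.1) u

theorem jointSmooth_shiftMap (H : IsIsometricAction αa) {u : A} (hu : u ∈ SmoothSet αa) :
    JointSmooth αa (shiftMap αa u) := by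
  have h : ContDiff ℝ ∞ (fun s : Rn n => αa s u) := contDiff_infty.2 hu
  have h' : orbitMap αa (shiftMap αa u) = fun h : Rn n × R2n n => αa (h.1 + -h.2.1) u := by
    ext h
    simp [orbitMap, shiftMap, H.add]
  unfold JointSmooth
  rw [h']
  exact h.comp (contDiff_fst.add (contDiff_fst.comp contDiff_snd).neg)

theorem mixedD_inr_shiftMap (H : IsIsometricAction αa) {u : A} (hu : u ∈ SmoothSet αa)
    (d : Fin n ⊕ Fin n) (x : R2n n) :
    mixedD αa (.inr d) (shiftMap αa u) x =
      -(orbitDeriv fun j => αa (-x.1) (δd αa j u)) (diffDir (.inr d)).2.1 := by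
  have h : HasFDerivAt (shiftMap αa u) ((orbitDeriv fun j => αa (-x.1) (δd αa j u)).comp
      (-(ContinuousLinearMap.fst ℝ (Rn n) (Rn n)))) x :=
    (hasFDerivAt_orbit H hu (-x.1)).comp (f := fun x : R2n n => -x.1) x hasFDerivAt_fst.neg
  rw [mixedD_inr H (jointSmooth_shiftMap H hu), h.fderiv]
  simp

theorem derivBound_shiftMap (H : IsIsometricAction αa) {u : A} (hu : u ∈ SmoothSet αa) {K : ℝ}
    (N : ℕ) (hK : ∀ c : Fin n → ℕ, mdeg c ≤ N → ‖δpow αa c u‖ ≤ K) :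
    DerivBound αa 0 N K (shiftMap αa u) := by
  have h0 : ∀ x : R2n n, ‖shiftMap αa u x‖ ≤ K * (1 + ‖x.1‖ + ‖x.2‖) ^ (0 : ℝ) := fun x => by
    simpa [shiftMap, H.norm_map, δpow_zero] using hK 0 (by simp [mdeg])
  have hK0 : 0 ≤ K := (norm_nonneg _).trans (hK 0 (by simp [mdeg]))
  induction N generalizing u with
  | zero => exact h0
  | succ N ih =>
    have hj : ∀ j, DerivBound αa 0 N K (shiftMap αa (δd αa j u)) := fun j => by
      have hK' : ∀ c : Fin n → ℕ, mdeg c ≤ N → ‖δpow αa c (δd αa j u)‖ ≤ K := fun c hc => by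
        rw [δpow_δd H hu]
        exact hK _ (by rw [mdeg_add_single]; omega)
      exact ih (δd_mem H hu j) hK' fun x => by
        simpa [shiftMap, H.norm_map, δpow_zero] using hK' 0 (by simp [mdeg])
    refine ⟨h0, fun d => ?_⟩
    rcases d with j | j | j
    · have h : mixedD αa (.inl j) (shiftMap αa u) = shiftMap αa (δd αa j u) := by
        ext x
        rw [mixedD_inl (jointSmooth_shiftMap H hu)]
        have h' : (fun s : Rn n => αa s (shiftMap αa u x)) = fun s => αa (s + -x.1) u := by
          ext s
          simp [shiftMap, H.add]
        have h5 : HasFDerivAt (fun s : Rn n => αa s (shiftMap αa u x))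
            (orbitDeriv fun j => αa (0 + -x.1) (δd αa j u)) 0 := by
          rw [h']
          exact (hasFDerivAt_comp_add_right (-x.1)).2 (hasFDerivAt_orbit H hu (0 + -x.1))
        rw [δd, h5.fderiv, orbitDeriv_single, smul_smul]
        simp [shiftMap]
      rw [h]
      exact hj j
    · have h : mixedD αa (.inr (.inl j)) (shiftMap αa u) =
          fun x => (-Complex.I) • shiftMap αa (δd αa j u) x := by
        ext x
        rw [mixedD_inr_shiftMap H hu]
        simp [diffDir, orbitDeriv_single, shiftMap]
      rw [h]
      simpa using (hj j).const_smul (jointSmooth_shiftMap H (δd_mem H hu j)) H (-Complex.I)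
    · have h : mixedD αa (.inr (.inr j)) (shiftMap αa u) =
          fun x => (0 : ℂ) • shiftMap αa (δd αa j u) x := by
        ext x
        rw [mixedD_inr_shiftMap H hu]
        simp [diffDir]
      rw [h]
      exact ((hj j).const_smul (jointSmooth_shiftMap H (δd_mem H hu j)) H 0).mono le_rfl
        (by simpa using hK0)

theorem IsAmplitude.derivBound_mul_shiftMap (H : IsIsometricAction αa) {m : ℝ}
    (hf : IsAmplitude αa m f) {u : A} (hu : u ∈ SmoothSet αa) (N : ℕ) :
    DerivBound αa m N (2 ^ N * (qSemi αa m N f * frSemi αa N u))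
      (fun x => f x * αa (-x.1) u) := by
  have h := (hf.derivBound H N).mul (hf.jointSmooth H) (jointSmooth_shiftMap H hu) H
    (derivBound_shiftMap H hu N fun c hc => norm_δpow_le_frSemi u hc)
  rwa [add_zero] at h

theorem IsAmplitude.jointSmooth_mul_shiftMap (H : IsIsometricAction αa) {m : ℝ}
    (hf : IsAmplitude αa m f) {u : A} (hu : u ∈ SmoothSet αa) :
    JointSmooth αa (fun x => f x * αa (-x.1) u) :=
  (hf.jointSmooth H).mul (jointSmooth_shiftMap H hu)

theorem IsAmplitude.mul_shiftMap (H : IsIsometricAction αa) {m : ℝ}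
    (hf : IsAmplitude αa m f) {u : A} (hu : u ∈ SmoothSet αa) :
    IsAmplitude αa m (fun x => f x * αa (-x.1) u) :=
  (hf.jointSmooth_mul_shiftMap H hu).isAmplitude H fun N => ⟨_, hf.derivBound_mul_shiftMap H hu N⟩

theorem orbitMap_smul (H : IsIsometricAction αa) (p : R2n n → ℝ) (f : R2n n → A) :
    orbitMap αa (fun x => p x • f x) = fun h => p h.2 • orbitMap αa f h :=
  funext fun h => (H.toCLM h.1).map_smul (p h.2) (f h.2)

theorem JointSmooth.smul (H : IsIsometricAction αa) {p : R2n n → ℝ} (hp : ContDiff ℝ ∞ p)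
    (hf : JointSmooth αa f) : JointSmooth αa (fun x => p x • f x) := by
  unfold JointSmooth
  rw [orbitMap_smul H]
  exact (hp.comp contDiff_snd).smul hf

theorem mixedD_smul (H : IsIsometricAction αa) {p : R2n n → ℝ} (hf : JointSmooth αa f)
    (d : DiffIndex n) {x : R2n n} (hp : DifferentiableAt ℝ p x) :
    mixedD αa d (fun x => p x • f x) x =
      p x • mixedD αa d f x + fderiv ℝ p x (diffDir d).2 • f x := by
  have h1 : HasFDerivAt (fun h : Rn n × R2n n => p h.2)
      ((fderiv ℝ p x).comp (ContinuousLinearMap.snd ℝ (Rn n) (R2n n))) (0, x) :=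
    HasFDerivAt.comp (f := Prod.snd) (0, x) hp.hasFDerivAt hasFDerivAt_snd
  have h := h1.smul (hf.differentiable (0, x)).hasFDerivAt
  have h' : fderiv ℝ (orbitMap αa fun x => p x • f x) (0, x) = _ :=
    (congrArg (fun F => fderiv ℝ F (0, x)) (orbitMap_smul H p f)).trans h.fderiv
  rw [mixedD, h', mixedD]
  rcases d with j | j | j
  · simp only [diffCoef, diffDir]
    rw [smul_comm (p x)]
    simp
  · simp [diffCoef, diffDir, orbitMap, H.zero]
  · simp [diffCoef, diffDir, orbitMap, H.zero]

theorem mixedD_congr {x : R2n n} (h : f =ᶠ[𝓝 x] g) (d : DiffIndex n) :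
    mixedD αa d f x = mixedD αa d g x := by
  have h' : orbitMap αa f =ᶠ[𝓝 (0, x)] orbitMap αa g := by
    have := (continuous_snd.tendsto ((0 : Rn n), x)).eventually h
    filter_upwards [this] with y hy
    simp [orbitMap, hy]
  rw [mixedD, mixedD, h'.fderiv_eq]

theorem jointSmooth_zero : JointSmooth αa (fun _ : R2n n => (0 : A)) := by
  have : orbitMap αa (fun _ : R2n n => (0 : A)) = fun _ => 0 := by ext; simp [orbitMap]
  unfold JointSmooth
  rw [this]
  exact contDiff_const

theorem mixedD_zero (d : DiffIndex n) :
    mixedD αa d (fun _ : R2n n => (0 : A)) = fun _ => 0 := by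
  have : orbitMap αa (fun _ : R2n n => (0 : A)) = fun _ => 0 := by ext; simp [orbitMap]
  ext x
  simp [mixedD, this]

theorem derivBound_zero (m : ℝ) (N : ℕ) {K : ℝ} (hK : 0 ≤ K) :
    DerivBound αa m N K (fun _ : R2n n => (0 : A)) := by
  have h0 : ∀ x : R2n n, ‖(0 : A)‖ ≤ K * (1 + ‖x.1‖ + ‖x.2‖) ^ m := fun x => by
    rw [norm_zero]
    exact mul_nonneg hK (Real.rpow_nonneg (weight_pos x).le _)
  induction N with
  | zero => exact h0
  | succ N ih => exact ⟨h0, fun d => by rwa [mixedD_zero]⟩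

theorem JointSmooth.sum {ι : Type*} {F : ι → R2n n → A} (s : Finset ι)
    (hF : ∀ i, JointSmooth αa (F i)) : JointSmooth αa (fun x => ∑ i ∈ s, F i x) := by
  classical
  induction s using Finset.induction_on with
  | empty => simpa using jointSmooth_zero
  | insert i s hi ih =>
    simp only [Finset.sum_insert hi]
    exact (hF i).add ih

theorem DerivBound.sum (H : IsIsometricAction αa) {ι : Type*} {F : ι → R2n n → A} (s : Finset ι)
    (hF : ∀ i, JointSmooth αa (F i)) {m : ℝ} {N : ℕ} {K : ι → ℝ}
    (h : ∀ i, DerivBound αa m N (K i) (F i)) :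
    DerivBound αa m N (∑ i ∈ s, K i) (fun x => ∑ i ∈ s, F i x) := by
  classical
  induction s using Finset.induction_on with
  | empty => simpa using derivBound_zero m N le_rfl
  | insert i s hi ih =>
    simp only [Finset.sum_insert hi]
    exact (h i).add (hF i) (JointSmooth.sum s hF) H ih

/-- The maps all of whose derivatives are of order `μ`. -/
structure HasSymbolOrder (αa : Rn n → (A ≃⋆ₐ[ℂ] A)) (μ : ℝ) (f : R2n n → A) : Prop where
  jointSmooth : JointSmooth αa f
  bound : ∀ N, ∃ K, DerivBound αa μ N K f

theorem exists_derivBound_succ {m : ℝ} {N : ℕ}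
    (h0 : ∃ K, ∀ x : R2n n, ‖f x‖ ≤ K * (1 + ‖x.1‖ + ‖x.2‖) ^ m)
    (h : ∀ d, ∃ K, DerivBound αa m N K (mixedD αa d f)) : ∃ K, DerivBound αa m (N + 1) K f := by
  obtain ⟨K₀, h0⟩ := h0
  choose K hK using h
  have hK₀ : 0 ≤ K₀ := by simpa using (norm_nonneg _).trans (h0 0)
  have hs : 0 ≤ ∑ d, K d := Finset.sum_nonneg fun d _ => (hK d).nonneg
  refine ⟨K₀ + ∑ d, K d, fun x => (h0 x).trans ?_, fun d => (hK d).mono le_rfl ?_⟩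
  · exact mul_le_mul_of_nonneg_right (by linarith) (Real.rpow_nonneg (weight_pos x).le _)
  · have := Finset.single_le_sum (fun d _ => (hK d).nonneg) (Finset.mem_univ d)
    linarith

theorem HasSymbolOrder.mixedD (H : IsIsometricAction αa) {μ : ℝ} (h : HasSymbolOrder αa μ f)
    (d : DiffIndex n) : HasSymbolOrder αa μ (mixedD αa d f) where
  jointSmooth := h.jointSmooth.mixedD H d
  bound N := by
    obtain ⟨K, hK⟩ := h.bound (N + 1)
    exact ⟨K, hK.2 d⟩

theorem HasSymbolOrder.add (H : IsIsometricAction αa) {μ : ℝ} (hf : HasSymbolOrder αa μ f)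
    (hg : HasSymbolOrder αa μ g) : HasSymbolOrder αa μ (fun x => f x + g x) where
  jointSmooth := hf.jointSmooth.add hg.jointSmooth
  bound N := by
    obtain ⟨K, hK⟩ := hf.bound N
    obtain ⟨L, hL⟩ := hg.bound N
    exact ⟨_, hK.add hf.jointSmooth hg.jointSmooth H hL⟩

theorem HasSymbolOrder.const_smul (H : IsIsometricAction αa) {μ : ℝ}
    (hf : HasSymbolOrder αa μ f) (c : ℂ) : HasSymbolOrder αa μ (fun x => c • f x) where
  jointSmooth := hf.jointSmooth.const_smul c
  bound N := by
    obtain ⟨K, hK⟩ := hf.bound N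
    exact ⟨_, hK.const_smul hf.jointSmooth H c⟩

theorem HasSymbolOrder.mono {μ ν : ℝ} (hf : HasSymbolOrder αa μ f) (h : μ ≤ ν) :
    HasSymbolOrder αa ν f where
  jointSmooth := hf.jointSmooth
  bound N := by
    obtain ⟨K, hK⟩ := hf.bound N
    exact ⟨K, hK.mono h le_rfl⟩

theorem HasSymbolOrder.smul (H : IsIsometricAction αa) {μ ν : ℝ} {p : R2n n → ℝ}
    (hp : HasSymbolOrder αa μ (fun x => p x • (1 : A))) (hf : HasSymbolOrder αa ν f) :
    HasSymbolOrder αa (μ + ν) (fun x => p x • f x) := by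
  have h : (fun x => p x • f x) = fun x => (p x • (1 : A)) * f x := by
    ext x
    rw [smul_mul_assoc, one_mul]
  rw [h]
  refine ⟨hp.jointSmooth.mul hf.jointSmooth, fun N => ?_⟩
  obtain ⟨K, hK⟩ := hp.bound N
  obtain ⟨L, hL⟩ := hf.bound N
  exact ⟨_, hK.mul hp.jointSmooth hf.jointSmooth H hL⟩

theorem one_mem_smoothSet : (1 : A) ∈ SmoothSet αa := fun N => by
  simpa using contDiff_const

theorem mixedD_smul_one (H : IsIsometricAction αa) {p : R2n n → ℝ} (hp : Differentiable ℝ p)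
    (d : DiffIndex n) :
    mixedD αa d (fun x => p x • (1 : A)) = fun x => fderiv ℝ p x (diffDir d).2 • (1 : A) := by
  ext x
  have h : orbitMap αa (fun _ : R2n n => (1 : A)) = fun _ => 1 := by ext; simp [orbitMap]
  rw [mixedD_smul H (jointSmooth_const one_mem_smoothSet) d (hp x)]
  simp [mixedD, h]

theorem jointSmooth_smul_one (H : IsIsometricAction αa) {p : R2n n → ℝ} (hp : ContDiff ℝ ∞ p) :
    JointSmooth αa (fun x => p x • (1 : A)) :=
  JointSmooth.smul H hp (jointSmooth_const one_mem_smoothSet)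

theorem hasSymbolOrder_const (H : IsIsometricAction αa) (c : ℝ) :
    HasSymbolOrder αa 0 (fun _ : R2n n => c • (1 : A)) where
  jointSmooth := jointSmooth_smul_one H contDiff_const
  bound N := by
    have h0 : ∃ K : ℝ, ∀ x : R2n n, ‖c • (1 : A)‖ ≤ K * (1 + ‖x.1‖ + ‖x.2‖) ^ (0 : ℝ) :=
      ⟨‖c • (1 : A)‖, fun x => by simp⟩
    cases N with
    | zero => exact h0
    | succ N =>
      refine exists_derivBound_succ h0 fun d => ⟨0, ?_⟩
      rw [mixedD_smul_one H (differentiable_const c)]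
      simpa using derivBound_zero 0 N le_rfl

theorem hasSymbolOrder_linear (H : IsIsometricAction αa) (l : R2n n →L[ℝ] ℝ) :
    HasSymbolOrder αa 1 (fun x => l x • (1 : A)) where
  jointSmooth := jointSmooth_smul_one H l.contDiff
  bound N := by
    have h0 : ∃ K : ℝ, ∀ x : R2n n, ‖l x • (1 : A)‖ ≤ K * (1 + ‖x.1‖ + ‖x.2‖) ^ (1 : ℝ) := by
      refine ⟨‖l‖ * ‖(1 : A)‖, fun x => ?_⟩
      have h1 : ‖x‖ ≤ 1 + ‖x.1‖ + ‖x.2‖ := by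
        have := norm_nonneg x.1
        have := norm_nonneg x.2
        exact max_le (by linarith) (by linarith)
      rw [norm_smul, Real.rpow_one, mul_right_comm]
      exact mul_le_mul_of_nonneg_right ((l.le_opNorm x).trans
        (mul_le_mul_of_nonneg_left h1 (norm_nonneg _))) (norm_nonneg _)
    cases N with
    | zero => exact h0
    | succ N =>
      refine exists_derivBound_succ h0 fun d => ?_
      rw [mixedD_smul_one H l.differentiable]
      simpa using ((hasSymbolOrder_const H (l (diffDir d).2)).mono zero_le_one).bound N

theorem hasSymbolOrder_compactSupport (H : IsIsometricAction αa) (μ : ℝ) {p : R2n n → ℝ}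
    (hp : ContDiff ℝ ∞ p) (hc : HasCompactSupport p) :
    HasSymbolOrder αa μ (fun x => p x • (1 : A)) where
  jointSmooth := jointSmooth_smul_one H hp
  bound N := by
    have h0 : ∀ p : R2n n → ℝ, Continuous p → HasCompactSupport p →
        ∃ K : ℝ, ∀ x : R2n n, ‖p x • (1 : A)‖ ≤ K * (1 + ‖x.1‖ + ‖x.2‖) ^ μ := by
      intro p hp hc
      obtain ⟨C, hC⟩ := (hc.smul_right (f' := fun x : R2n n =>
        (1 + ‖x.1‖ + ‖x.2‖) ^ (-μ) * ‖(1 : A)‖)).exists_bound_of_continuous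
        (hp.smul ((Continuous.rpow_const (by fun_prop) fun x => Or.inl (weight_pos x).ne').mul
          continuous_const))
      refine ⟨C, fun x => ?_⟩
      have hw := Real.rpow_pos_of_pos (weight_pos x) μ
      have h := hC x
      simp only [Pi.smul_apply', smul_eq_mul, norm_mul, norm_norm,
        Real.rpow_neg (weight_pos x).le, norm_inv, Real.norm_of_nonneg hw.le] at h
      rw [norm_smul]
      calc ‖p x‖ * ‖(1 : A)‖ = ‖p x‖ * (((1 + ‖x.1‖ + ‖x.2‖) ^ μ)⁻¹ * ‖(1 : A)‖) *
            (1 + ‖x.1‖ + ‖x.2‖) ^ μ := by field_simp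
        _ ≤ _ := mul_le_mul_of_nonneg_right h hw.le
    induction N generalizing p with
    | zero => exact h0 p hp.continuous hc
    | succ N ih =>
      refine exists_derivBound_succ (h0 p hp.continuous hc) fun d => ?_
      rw [mixedD_smul_one H (hp.differentiable (by simp))]
      exact ih ((contDiff_infty_iff_fderiv.1 hp).2.clm_apply contDiff_const)
        (hc.fderiv_apply (𝕜 := ℝ) _)

/-- The map `x ↦ f(x) / (|s|² + |ξ|²)^k`. -/
def radialDiv (k : ℕ) (f : R2n n → A) : R2n n → A :=
  fun x => ((‖x.1‖ ^ 2 + ‖x.2‖ ^ 2) ^ k)⁻¹ • f x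

/-- The linear form `x ↦ 2⟪x.1, v.1⟫ + 2⟪x.2, v.2⟫`. -/
def radialForm (v : R2n n) : R2n n →L[ℝ] ℝ :=
  (2 : ℝ) • ((innerSL ℝ v.1).comp (ContinuousLinearMap.fst ℝ (Rn n) (Rn n)) +
    (innerSL ℝ v.2).comp (ContinuousLinearMap.snd ℝ (Rn n) (Rn n)))

theorem sum_sq_ne_zero {x : R2n n} (hx : x ≠ 0) : ‖x.1‖ ^ 2 + ‖x.2‖ ^ 2 ≠ 0 := by
  intro h
  have h1 : ‖x.1‖ = 0 := by nlinarith [sq_nonneg ‖x.1‖, sq_nonneg ‖x.2‖]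
  have h2 : ‖x.2‖ = 0 := by nlinarith [sq_nonneg ‖x.1‖, sq_nonneg ‖x.2‖]
  exact hx (Prod.ext (norm_eq_zero.1 h1) (norm_eq_zero.1 h2))

theorem contDiff_sum_sq : ContDiff ℝ ∞ (fun x : R2n n => ‖x.1‖ ^ 2 + ‖x.2‖ ^ 2) :=
  (contDiff_fst.norm_sq ℝ).add (contDiff_snd.norm_sq ℝ)

theorem jointSmooth_radialDiv (H : IsIsometricAction αa) (k : ℕ) (hf : JointSmooth αa f)
    (h0 : f =ᶠ[𝓝 0] 0) : JointSmooth αa (radialDiv k f) := by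
  unfold JointSmooth radialDiv
  rw [orbitMap_smul H, contDiff_iff_contDiffAt]
  rintro ⟨s, x⟩
  by_cases hx : x = 0
  · subst hx
    refine (contDiffAt_const (c := (0 : A))).congr_of_eventuallyEq ?_
    filter_upwards [(continuous_snd.tendsto (s, (0 : R2n n))).eventually h0] with y hy
    simp [orbitMap, hy]
  · have h : ContDiffAt ℝ ∞ (fun h : Rn n × R2n n => (‖h.2.1‖ ^ 2 + ‖h.2.2‖ ^ 2) ^ k) (s, x) :=
      ((contDiff_sum_sq.comp contDiff_snd).pow k).contDiffAt
    have h' : ContDiffAt ℝ ∞ (fun h : Rn n × R2n n => ((‖h.2.1‖ ^ 2 + ‖h.2.2‖ ^ 2) ^ k)⁻¹) (s, x) :=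
      h.inv (pow_ne_zero k (sum_sq_ne_zero hx))
    exact h'.smul hf.contDiffAt

theorem hasFDerivAt_sum_sq (x : R2n n) :
    HasFDerivAt (fun x : R2n n => ‖x.1‖ ^ 2 + ‖x.2‖ ^ 2) (radialForm x) x := by
  have h1 := (hasFDerivAt_fst (𝕜 := ℝ) (p := x)).norm_sq
  have h2 := (hasFDerivAt_snd (𝕜 := ℝ) (p := x)).norm_sq
  refine (h1.add h2).congr_fderiv ?_
  ext v <;> simp [radialForm]

theorem mixedD_radialDiv (H : IsIsometricAction αa) (k : ℕ) (hf : JointSmooth αa f)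
    (h0 : f =ᶠ[𝓝 0] 0) (d : DiffIndex n) :
    mixedD αa d (radialDiv k f) = fun x => radialDiv k (mixedD αa d f) x +
      (-k : ℂ) • radialDiv (k + 1) (fun x => radialForm (diffDir d).2 x • f x) x := by
  ext x
  by_cases hx : x = 0
  · subst hx
    have h1 : mixedD αa d f 0 = 0 := by
      rw [mixedD_congr h0]
      exact congrFun (mixedD_zero d) 0
    have h2 : mixedD αa d (radialDiv k f) 0 = 0 := by
      have : radialDiv k f =ᶠ[𝓝 0] fun _ => 0 := by
        filter_upwards [h0] with y hy
        simp [radialDiv, hy]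
      rw [mixedD_congr this, mixedD_zero]
    simp [h1, h2, radialDiv, h0.eq_of_nhds]
  · have hq := sum_sq_ne_zero hx
    have hp : HasDerivAt (fun t : ℝ => (t ^ k)⁻¹)
        (-k * ((‖x.1‖ ^ 2 + ‖x.2‖ ^ 2) ^ (k + 1))⁻¹) (‖x.1‖ ^ 2 + ‖x.2‖ ^ 2) := by
      have h := hasDerivAt_zpow (-k) _ (Or.inl hq)
      simpa only [zpow_neg, zpow_natCast, Int.cast_neg, Int.cast_natCast,
        show (-k : ℤ) - 1 = -((k + 1 : ℕ) : ℤ) by push_cast; ring] using h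
    have hd := hp.comp_hasFDerivAt x (hasFDerivAt_sum_sq x)
    unfold radialDiv
    rw [mixedD_smul H (p := fun x : R2n n => ((‖x.1‖ ^ 2 + ‖x.2‖ ^ 2) ^ k)⁻¹) hf d
      hd.differentiableAt]
    have hd' : fderiv ℝ (fun x : R2n n => ((‖x.1‖ ^ 2 + ‖x.2‖ ^ 2) ^ k)⁻¹) x = _ := hd.fderiv
    rw [hd', show (-k : ℂ) = ((-k : ℝ) : ℂ) by simp, Complex.coe_smul, smul_smul, smul_smul]
    have hs : radialForm x (diffDir d).2 = radialForm (diffDir d).2 x := by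
      simp [radialForm, real_inner_comm]
    simp [hs, mul_assoc]

theorem exists_norm_radialDiv_le {μ K : ℝ} (hK : DerivBound αa μ 0 K f) (h0 : f =ᶠ[𝓝 0] 0)
    (k : ℕ) : ∃ K, ∀ x, ‖radialDiv k f x‖ ≤ K * (1 + ‖x.1‖ + ‖x.2‖) ^ (μ - 2 * k) := by
    obtain ⟨ε, hε, hb⟩ := Metric.eventually_nhds_iff.1 h0
    set c : ℝ := ε⁻¹ + 2
    have hc : 0 < c := by positivity
    refine ⟨K * (c ^ 2) ^ k, fun x => ?_⟩
    by_cases hx : ‖x‖ < ε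
    · have : f x = 0 := hb (by simpa using hx)
      simp only [radialDiv, this, smul_zero, norm_zero]
      exact mul_nonneg (mul_nonneg hK.nonneg (by positivity))
        (Real.rpow_nonneg (weight_pos x).le _)
    · push Not at hx
      have hw := weight_pos x
      have h1 : 1 + ‖x.1‖ + ‖x.2‖ ≤ c * ‖x‖ := by
        have h2 : 1 ≤ ε⁻¹ * ‖x‖ := by
          rw [inv_mul_eq_div, le_div_iff₀ hε, one_mul]
          exact hx
        have h3 := norm_fst_le x
        have h4 := norm_snd_le x
        simp only [c]
        linarith
      have h2 : ‖x‖ ^ 2 ≤ ‖x.1‖ ^ 2 + ‖x.2‖ ^ 2 := by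
        rcases max_choice ‖x.1‖ ‖x.2‖ with h | h <;> rw [Prod.norm_def, h] <;> nlinarith
      have h3 : (1 + ‖x.1‖ + ‖x.2‖) ^ 2 ≤ c ^ 2 * (‖x.1‖ ^ 2 + ‖x.2‖ ^ 2) :=
        (pow_le_pow_left₀ hw.le h1 2).trans (by
          rw [mul_pow]
          exact mul_le_mul_of_nonneg_left h2 (by positivity))
      have hq : 0 < ‖x.1‖ ^ 2 + ‖x.2‖ ^ 2 := lt_of_lt_of_le (pow_pos (hε.trans_le hx) 2) h2
      have h4 : ((‖x.1‖ ^ 2 + ‖x.2‖ ^ 2) ^ k)⁻¹ ≤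
          (c ^ 2) ^ k * ((1 + ‖x.1‖ + ‖x.2‖) ^ (2 * k))⁻¹ := by
        rw [← div_eq_mul_inv, le_div_iff₀ (by positivity), inv_mul_le_iff₀ (by positivity),
          pow_mul, ← mul_pow, mul_comm (_ + _)]
        exact pow_le_pow_left₀ (by positivity) h3 k
      have h5 : (1 + ‖x.1‖ + ‖x.2‖) ^ (μ - 2 * k) =
          (1 + ‖x.1‖ + ‖x.2‖) ^ μ * ((1 + ‖x.1‖ + ‖x.2‖) ^ (2 * k))⁻¹ := by
        rw [Real.rpow_sub hw, div_eq_mul_inv]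
        congr 2
        exact_mod_cast Real.rpow_natCast _ (2 * k)
      rw [radialDiv, norm_smul, Real.norm_of_nonneg (by positivity), h5]
      refine (mul_le_mul h4 (hK.norm_le x) (norm_nonneg _) (by positivity)).trans (le_of_eq ?_)
      ring

theorem HasSymbolOrder.radialDiv (H : IsIsometricAction αa) {μ : ℝ} (hf : HasSymbolOrder αa μ f)
    (h0 : f =ᶠ[𝓝 0] 0) (k : ℕ) : HasSymbolOrder αa (μ - 2 * k) (radialDiv k f) where
  jointSmooth := jointSmooth_radialDiv H k hf.jointSmooth h0
  bound N := by
    induction N generalizing f μ k with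
    | zero =>
      obtain ⟨K, hK⟩ := hf.bound 0
      exact exists_norm_radialDiv_le hK h0 k
    | succ N ih =>
      obtain ⟨K, hK⟩ := hf.bound 0
      refine exists_derivBound_succ (exists_norm_radialDiv_le hK h0 k) fun d => ?_
      rw [mixedD_radialDiv H k hf.jointSmooth h0]
      have e1 : _root_.mixedD αa d f =ᶠ[𝓝 0] 0 := by
        filter_upwards [eventually_eventually_nhds.2 h0] with y hy
        rw [mixedD_congr hy]
        exact congrFun (mixedD_zero d) y
      have e2 : (fun x => radialForm (diffDir d).2 x • f x) =ᶠ[𝓝 0] 0 := by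
        filter_upwards [h0] with y hy
        simp [hy]
      have s1 := HasSymbolOrder.mixedD H hf d
      have s2 := (hasSymbolOrder_linear H (radialForm (diffDir d).2)).smul H hf
      have j1 := jointSmooth_radialDiv H k s1.jointSmooth e1
      have j2 := jointSmooth_radialDiv H (k + 1) s2.jointSmooth e2
      obtain ⟨K₁, h1⟩ := ih s1 e1 k
      obtain ⟨K₂, h2⟩ := ih s2 e2 (k + 1)
      have h3 : DerivBound αa (μ - 2 * k) N K₂ _ :=
        h2.mono (by push_cast; linarith) le_rfl
      exact ⟨_, h1.add j1 (j2.const_smul _) H (h3.const_smul j2 H _)⟩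

theorem hasSymbolOrder_Lcoef_mul (H : IsIsometricAction αa) {χc : R2n n → ℝ}
    (hχ : ContDiff ℝ ∞ χc) (hc : HasCompactSupport χc) (h1 : ∀ᶠ x in 𝓝 (0 : R2n n), χc x = 1)
    (l : R2n n →L[ℝ] ℝ) :
    HasSymbolOrder αa (-1) (fun x => (Lcoef χc x * l x) • (1 : A)) := by
  have h2 : HasSymbolOrder αa 0 (fun x => (1 - χc x) • (1 : A)) := by
    have h := (hasSymbolOrder_const H 1).add H
      ((hasSymbolOrder_compactSupport H 0 hχ hc).const_smul H (-1))
    simpa [sub_smul, sub_eq_add_neg, add_smul] using h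
  have h3 := h2.smul H (hasSymbolOrder_linear H l)
  have h4 : (fun x => (1 - χc x) • l x • (1 : A)) =ᶠ[𝓝 0] 0 := by
    filter_upwards [h1] with x hx
    simp [hx]
  have h5 := h3.radialDiv H h4 1
  have h6 : (fun x => (Lcoef χc x * l x) • (1 : A)) =
      radialDiv 1 (fun x => (1 - χc x) • l x • (1 : A)) := by
    ext x
    simp only [radialDiv, Lcoef, smul_smul, pow_one]
    congr 1
    ring
  rw [h6]
  exact h5.mono (by norm_num)

theorem exists_derivBound_smul (H : IsIsometricAction αa) {μ : ℝ} {p : R2n n → ℝ}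
    (hp : HasSymbolOrder αa μ (fun x => p x • (1 : A))) (M : ℕ) :
    ∃ C : ℝ, 0 ≤ C ∧ ∀ (m K : ℝ) (u : R2n n → A), JointSmooth αa u → DerivBound αa m M K u →
      DerivBound αa (m + μ) M (C * K) (fun x => p x • u x) := by
  obtain ⟨L, hL⟩ := hp.bound M
  refine ⟨2 ^ M * L, mul_nonneg (by positivity) hL.nonneg, fun m K u hu h => ?_⟩
  have h2 : (fun x => p x • u x) = fun x => (p x • (1 : A)) * u x := by
    ext x
    rw [smul_mul_assoc, one_mul]
  rw [h2]
  have h3 := hL.mul hp.jointSmooth hu H h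
  rw [add_comm m, mul_assoc]
  exact h3

theorem hasSymbolOrder_Lcoef_snd (H : IsIsometricAction αa) {χc : R2n n → ℝ}
    (hχ : ContDiff ℝ ∞ χc) (hc : HasCompactSupport χc) (h1 : ∀ᶠ x in 𝓝 (0 : R2n n), χc x = 1)
    (j : Fin n) : HasSymbolOrder αa (-1) (fun x => (Lcoef χc x * x.2 j) • (1 : A)) :=
  hasSymbolOrder_Lcoef_mul H hχ hc h1
    ((EuclideanSpace.proj j).comp (ContinuousLinearMap.snd ℝ (Rn n) (Rn n)))

theorem hasSymbolOrder_Lcoef_fst (H : IsIsometricAction αa) {χc : R2n n → ℝ}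
    (hχ : ContDiff ℝ ∞ χc) (hc : HasCompactSupport χc) (h1 : ∀ᶠ x in 𝓝 (0 : R2n n), χc x = 1)
    (j : Fin n) : HasSymbolOrder αa (-1) (fun x => (Lcoef χc x * x.1 j) • (1 : A)) :=
  hasSymbolOrder_Lcoef_mul H hχ hc h1
    ((EuclideanSpace.proj j).comp (ContinuousLinearMap.fst ℝ (Rn n) (Rn n)))

theorem HasSymbolOrder.jointSmooth_smul {μ : ℝ} {p : R2n n → ℝ}
    (hp : HasSymbolOrder αa μ (fun x => p x • (1 : A))) (hf : JointSmooth αa f) :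
    JointSmooth αa (fun x => p x • f x) := by
  simpa only [smul_mul_assoc, one_mul] using hp.jointSmooth.mul hf

theorem Ltrans_eq (H : IsIsometricAction αa) {χc : R2n n → ℝ}
    (hχ : ContDiff ℝ ∞ χc) (hc : HasCompactSupport χc) (h1 : ∀ᶠ x in 𝓝 (0 : R2n n), χc x = 1)
    (hf : JointSmooth αa f) :
    Ltrans χc f = fun x => χc x • f x + ∑ j, (Complex.I •
      mixedD αa (.inr (.inl j)) (fun y => (Lcoef χc y * y.2 j) • f y) x +
      Complex.I • mixedD αa (.inr (.inr j)) (fun y => (Lcoef χc y * y.1 j) • f y) x) := by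
  ext x
  rw [Ltrans, sub_eq_add_neg, ← Finset.sum_neg_distrib]
  congr 1
  refine Finset.sum_congr rfl fun j _ => ?_
  rw [mixedD_pdS H ((hasSymbolOrder_Lcoef_snd H hχ hc h1 j).jointSmooth_smul hf),
    mixedD_pdXi H ((hasSymbolOrder_Lcoef_fst H hχ hc h1 j).jointSmooth_smul hf)]
  simp only [neg_smul, neg_add, neg_neg]

theorem Ltrans_add (H : IsIsometricAction αa) {χc : R2n n → ℝ}
    (hχ : ContDiff ℝ ∞ χc) (hc : HasCompactSupport χc) (h1 : ∀ᶠ x in 𝓝 (0 : R2n n), χc x = 1)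
    (hf : JointSmooth αa f) (hg : JointSmooth αa g) :
    Ltrans χc (fun x => f x + g x) = fun x => Ltrans χc f x + Ltrans χc g x := by
  have hs := fun j => hasSymbolOrder_Lcoef_snd H hχ hc h1 j
  have hx := fun j => hasSymbolOrder_Lcoef_fst H hχ hc h1 j
  rw [Ltrans_eq H hχ hc h1 (hf.add hg), Ltrans_eq H hχ hc h1 hf, Ltrans_eq H hχ hc h1 hg]
  ext x
  simp only [smul_add, mixedD_add ((hs _).jointSmooth_smul hf) ((hs _).jointSmooth_smul hg),
    mixedD_add ((hx _).jointSmooth_smul hf) ((hx _).jointSmooth_smul hg), Finset.sum_add_distrib]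
  abel

theorem Ltrans_const_smul (H : IsIsometricAction αa) {χc : R2n n → ℝ}
    (hχ : ContDiff ℝ ∞ χc) (hc : HasCompactSupport χc) (h1 : ∀ᶠ x in 𝓝 (0 : R2n n), χc x = 1)
    (hf : JointSmooth αa f) (c : ℂ) :
    Ltrans χc (fun x => c • f x) = fun x => c • Ltrans χc f x := by
  have hs := fun j => hasSymbolOrder_Lcoef_snd H hχ hc h1 j
  have hx := fun j => hasSymbolOrder_Lcoef_fst H hχ hc h1 j
  rw [Ltrans_eq H hχ hc h1 (hf.const_smul c), Ltrans_eq H hχ hc h1 hf]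
  ext x
  simp only [smul_comm _ c, mixedD_const_smul ((hs _).jointSmooth_smul hf),
    mixedD_const_smul ((hx _).jointSmooth_smul hf), smul_add, Finset.smul_sum]

theorem JointSmooth.Ltrans (H : IsIsometricAction αa) {χc : R2n n → ℝ}
    (hχ : ContDiff ℝ ∞ χc) (hc : HasCompactSupport χc) (h1 : ∀ᶠ x in 𝓝 (0 : R2n n), χc x = 1)
    (hf : JointSmooth αa f) : JointSmooth αa (Ltrans χc f) := by
  have t₁ := fun j => ((hasSymbolOrder_Lcoef_snd H hχ hc h1 j).jointSmooth_smul hf).mixedD H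
    (.inr (.inl j))
  have t₂ := fun j => ((hasSymbolOrder_Lcoef_fst H hχ hc h1 j).jointSmooth_smul hf).mixedD H
    (.inr (.inr j))
  rw [Ltrans_eq H hχ hc h1 hf]
  exact (JointSmooth.smul H hχ hf).add (JointSmooth.sum _ fun j =>
    ((t₁ j).const_smul Complex.I).add ((t₂ j).const_smul Complex.I))

theorem exists_derivBound_Ltrans (H : IsIsometricAction αa) {χc : R2n n → ℝ}
    (hχ : ContDiff ℝ ∞ χc) (hc : HasCompactSupport χc) (h1 : ∀ᶠ x in 𝓝 (0 : R2n n), χc x = 1)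
    (M : ℕ) :
    ∃ C : ℝ, 0 ≤ C ∧ ∀ (m K : ℝ) (u : R2n n → A), JointSmooth αa u →
      DerivBound αa m (M + 1) K u →
      DerivBound αa (m - 1) M (C * K) (Ltrans χc u) := by
  have s₀ := hasSymbolOrder_compactSupport H (-1) hχ hc
  have s₁ := hasSymbolOrder_Lcoef_snd H hχ hc h1
  have s₂ := hasSymbolOrder_Lcoef_fst H hχ hc h1
  obtain ⟨C₀, hC₀, h₀⟩ := exists_derivBound_smul H s₀ M
  choose C₁ hC₁ h₁ using fun j => exists_derivBound_smul H (s₁ j) (M + 1)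
  choose C₂ hC₂ h₂ using fun j => exists_derivBound_smul H (s₂ j) (M + 1)
  refine ⟨C₀ + ∑ j, (C₁ j + C₂ j), add_nonneg hC₀ (Finset.sum_nonneg fun j _ =>
    add_nonneg (hC₁ j) (hC₂ j)), fun m K u hu hK => ?_⟩
  have hs := s₀.jointSmooth_smul hu
  have hb := h₀ m K u hu hK.of_succ
  have hb₁ := fun j => (h₁ j m K u hu hK).2 (.inr (.inl j))
  have hb₂ := fun j => (h₂ j m K u hu hK).2 (.inr (.inr j))
  have t₁ := fun j => ((s₁ j).jointSmooth_smul hu).mixedD H (.inr (.inl j))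
  have t₂ := fun j => ((s₂ j).jointSmooth_smul hu).mixedD H (.inr (.inr j))
  have ts := fun j => ((t₁ j).const_smul Complex.I).add ((t₂ j).const_smul Complex.I)
  have tb := fun j => ((hb₁ j).const_smul (t₁ j) H Complex.I).add ((t₁ j).const_smul Complex.I)
    ((t₂ j).const_smul Complex.I) H ((hb₂ j).const_smul (t₂ j) H Complex.I)
  rw [Ltrans_eq H hχ hc h1 hu]
  refine (hb.add hs (JointSmooth.sum _ ts) H (DerivBound.sum H _ ts tb)).mono le_rfl (le_of_eq ?_)
  simp [add_mul, Finset.sum_mul]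

theorem exists_derivBound_iterate_Ltrans (H : IsIsometricAction αa) {χc : R2n n → ℝ}
    (hχ : ContDiff ℝ ∞ χc) (hc : HasCompactSupport χc) (h1 : ∀ᶠ x in 𝓝 (0 : R2n n), χc x = 1)
    (N M : ℕ) :
    ∃ C : ℝ, 0 ≤ C ∧ ∀ (m K : ℝ) (u : R2n n → A), JointSmooth αa u →
      DerivBound αa m (M + N) K u →
      DerivBound αa (m - N) M (C * K) ((Ltrans χc)^[N] u) := by
  induction N with
  | zero => exact ⟨1, zero_le_one, fun m K u hu h => by simpa using h⟩
  | succ N ih =>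
    obtain ⟨C, hC, hi⟩ := ih
    obtain ⟨C', hC', hl⟩ := exists_derivBound_Ltrans H hχ hc h1 (M + N)
    refine ⟨C * C', mul_nonneg hC hC', fun m K u hu h => ?_⟩
    rw [Function.iterate_succ_apply, mul_assoc, show m - ((N + 1 : ℕ) : ℝ) = m - 1 - N by push_cast; ring]
    exact hi _ _ _ (hu.Ltrans H hχ hc h1) (hl m K u hu h)

theorem iterate_Ltrans_add (H : IsIsometricAction αa) {χc : R2n n → ℝ}
    (hχ : ContDiff ℝ ∞ χc) (hc : HasCompactSupport χc) (h1 : ∀ᶠ x in 𝓝 (0 : R2n n), χc x = 1)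
    (hf : JointSmooth αa f) (hg : JointSmooth αa g) (N : ℕ) :
    (Ltrans χc)^[N] (fun x => f x + g x) = fun x => (Ltrans χc)^[N] f x + (Ltrans χc)^[N] g x := by
  induction N generalizing f g with
  | zero => rfl
  | succ N ih =>
    rw [Function.iterate_succ_apply, Ltrans_add H hχ hc h1 hf hg,
      ih (hf.Ltrans H hχ hc h1) (hg.Ltrans H hχ hc h1)]
    rfl

theorem iterate_Ltrans_const_smul (H : IsIsometricAction αa) {χc : R2n n → ℝ}
    (hχ : ContDiff ℝ ∞ χc) (hc : HasCompactSupport χc) (h1 : ∀ᶠ x in 𝓝 (0 : R2n n), χc x = 1)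
    (hf : JointSmooth αa f) (c : ℂ) (N : ℕ) :
    (Ltrans χc)^[N] (fun x => c • f x) = fun x => c • (Ltrans χc)^[N] f x := by
  induction N generalizing f with
  | zero => rfl
  | succ N ih =>
    rw [Function.iterate_succ_apply, Ltrans_const_smul H hχ hc h1 hf,
      ih (hf.Ltrans H hχ hc h1)]
    rfl

open MeasureTheory in
theorem integrable_weight {r : ℝ} (hr : (2 * n : ℝ) < r) :
    Integrable (fun x : R2n n => (1 + ‖x.1‖ + ‖x.2‖) ^ (-r)) := by
  have : Measure.IsAddHaarMeasure (volume : Measure (R2n n)) :=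
    inferInstanceAs (Measure.IsAddHaarMeasure ((volume : Measure (Rn n)).prod volume))
  have h := integrable_one_add_norm (E := R2n n) (μ := volume) (r := r) (by
    rw [Module.finrank_prod, finrank_euclideanSpace_fin]
    push_cast
    linarith)
  refine h.mono' ?_ (Eventually.of_forall fun x => ?_)
  · exact (Continuous.rpow_const (by fun_prop) fun x =>
      Or.inl (weight_pos x).ne').aestronglyMeasurable
  · rw [Real.norm_of_nonneg (Real.rpow_nonneg (weight_pos x).le _)]
    have hn : ‖x‖ ≤ ‖x.1‖ + ‖x.2‖ :=
      max_le (by linarith [norm_nonneg x.2]) (by linarith [norm_nonneg x.1])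
    exact Real.rpow_le_rpow_of_nonpos (by positivity) (by linarith) (by
      have : (0 : ℝ) ≤ 2 * n := by positivity
      linarith)

variable {e : R2n n → ℂ} {r : ℝ}

theorem norm_smul_le_weight (he1 : ∀ x, ‖e x‖ ≤ 1) {K : ℝ}
    {E : Type*} [NormedAddCommGroup E] [NormedSpace ℂ E] {φ : R2n n → E}
    (h : ∀ x, ‖φ x‖ ≤ K * (1 + ‖x.1‖ + ‖x.2‖) ^ (-r)) (x : R2n n) :
    ‖e x • φ x‖ ≤ K * (1 + ‖x.1‖ + ‖x.2‖) ^ (-r) := by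
  rw [norm_smul]
  exact (mul_le_of_le_one_left (norm_nonneg _) (he1 x)).trans (h x)

open MeasureTheory in
theorem integrable_smul_of_bound (he : Continuous e) (he1 : ∀ x, ‖e x‖ ≤ 1)
    (hr : (2 * n : ℝ) < r) {K : ℝ}
    {E : Type*} [NormedAddCommGroup E] [NormedSpace ℂ E] {φ : R2n n → E} (hφ : Continuous φ)
    (h : ∀ x, ‖φ x‖ ≤ K * (1 + ‖x.1‖ + ‖x.2‖) ^ (-r)) :
    Integrable (fun x => e x • φ x) :=
  ((integrable_weight hr).const_mul K).mono' (he.smul hφ).aestronglyMeasurable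
    (Eventually.of_forall (norm_smul_le_weight he1 h))

theorem HasSymbolOrder.continuous (H : IsIsometricAction αa) {μ : ℝ}
    (hf : HasSymbolOrder αa μ f) : Continuous f :=
  (hf.jointSmooth.contDiff H).continuous

open MeasureTheory in
theorem HasSymbolOrder.integrable (H : IsIsometricAction αa) (he : Continuous e)
    (he1 : ∀ x, ‖e x‖ ≤ 1) (hr : (2 * n : ℝ) < r) (hf : HasSymbolOrder αa (-r) f) :
    Integrable (fun x => e x • f x) := by
  obtain ⟨K, hK⟩ := hf.bound 0
  exact integrable_smul_of_bound he he1 hr (hf.continuous H) hK.norm_le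

open MeasureTheory in
theorem HasSymbolOrder.map_integral (H : IsIsometricAction αa) (he : Continuous e)
    (he1 : ∀ x, ‖e x‖ ≤ 1) (hr : (2 * n : ℝ) < r) (hf : HasSymbolOrder αa (-r) f) (s : Rn n) :
    αa s (∫ x, e x • f x) = ∫ x, e x • αa s (f x) := by
  have h := (H.toCLM s).integral_comp_comm (hf.integrable H he he1 hr)
  rw [← H.toCLM_apply, ← h]
  simp only [H.toCLM_apply, map_smul]

open MeasureTheory in
theorem HasSymbolOrder.hasFDerivAt_integral (H : IsIsometricAction αa) (he : Continuous e)
    (he1 : ∀ x, ‖e x‖ ≤ 1) (hr : (2 * n : ℝ) < r) (hf : HasSymbolOrder αa (-r) f) (s : Rn n) :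
    HasFDerivAt (fun s => αa s (∫ x, e x • f x))
      (orbitDeriv fun j => αa s (∫ x, e x • _root_.mixedD αa (.inl j) f x)) s := by
  obtain ⟨K, hK⟩ := hf.bound 1
  have hcα : ∀ (s : Rn n) {φ : R2n n → A}, Continuous φ → Continuous fun x => αa s (φ x) :=
    fun s φ hφ => (H.toCLM s).continuous.comp hφ
  have hD := fun j => hf.mixedD H (.inl j)
  have hbD : ∀ (s : Rn n) (x : R2n n),
      ‖orbitDeriv fun j => αa s (_root_.mixedD αa (.inl j) f x)‖ ≤
      (n * K) * (1 + ‖x.1‖ + ‖x.2‖) ^ (-r) := fun s x => by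
    refine (norm_orbitDeriv_le _).trans ((Finset.sum_le_sum fun j _ =>
      (H.norm_map s _).le.trans ((hK.2 (.inl j)).norm_le x)).trans (le_of_eq ?_))
    simp [mul_assoc]
  have hcD : ∀ s : Rn n, Continuous fun x =>
      orbitDeriv fun j => αa s (_root_.mixedD αa (.inl j) f x) :=
    fun s => by
      simp only [orbitDeriv]
      exact continuous_finsetSum _ fun j _ =>
        (ContinuousLinearMap.smulRightL ℝ (Rn n) A (EuclideanSpace.proj j)).continuous.comp
          ((hcα s ((hD j).continuous H)).const_smul Complex.I)
  have hiD := fun s => integrable_smul_of_bound he he1 hr (hcD s) (hbD s)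
  have key := hasFDerivAt_integral_of_dominated_of_fderiv_le (μ := volume) (𝕜 := ℝ)
    (F := fun s x => e x • αa s (f x))
    (F' := fun s x => e x • orbitDeriv fun j => αa s (_root_.mixedD αa (.inl j) f x)) (x₀ := s)
    (s := Set.univ)
    (bound := fun x => (n * K) * (1 + ‖x.1‖ + ‖x.2‖) ^ (-r)) univ_mem
    (Eventually.of_forall fun s => (he.smul (hcα s (hf.continuous H))).aestronglyMeasurable)
    (integrable_smul_of_bound he he1 hr (hcα s (hf.continuous H)) (K := K) fun x => by
      rw [H.norm_map]
      exact hK.norm_le x)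
    (he.smul (hcD s)).aestronglyMeasurable
    (Eventually.of_forall fun x s _ => norm_smul_le_weight he1 (hbD s) x)
    ((integrable_weight hr).const_mul _)
    (Eventually.of_forall fun x s _ => by
      simp only [mixedD_inl hf.jointSmooth]
      exact (hasFDerivAt_orbit H (hf.jointSmooth.mem_smoothSet x) s).const_smul (e x))
  have h1 : (fun s => αa s (∫ x, e x • f x)) = fun s => ∫ x, e x • αa s (f x) :=
    funext fun s => hf.map_integral H he he1 hr s
  rw [h1]
  refine key.congr_fderiv (ContinuousLinearMap.ext fun v => ?_)
  rw [ContinuousLinearMap.integral_apply (hiD s), orbitDeriv_apply]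
  simp only [smul_apply, orbitDeriv_apply, Finset.smul_sum]
  rw [integral_finsetSum]
  · refine Finset.sum_congr rfl fun j _ => ?_
    rw [(hD j).map_integral H he he1 hr, ← integral_smul, ← integral_smul]
    refine integral_congr_ae (Eventually.of_forall fun x => ?_)
    simp only [smul_comm (e x)]
  · intro j _
    have := integrable_smul_of_bound (r := r) (K := K) he he1 hr (hcα s ((hD j).continuous H))
      fun x => by
        rw [H.norm_map]
        exact (hK.2 (.inl j)).norm_le x
    simp only [smul_comm (e _)]
    exact (this.smul Complex.I).smul (v j)

open MeasureTheory in
theorem HasSymbolOrder.integral_mem (H : IsIsometricAction αa) (he : Continuous e)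
    (he1 : ∀ x, ‖e x‖ ≤ 1) (hr : (2 * n : ℝ) < r) (hf : HasSymbolOrder αa (-r) f) :
    ∫ x, e x • f x ∈ SmoothSet αa := by
  intro N
  induction N generalizing f with
  | zero => exact contDiff_zero.2 (continuous_iff_continuousAt.2 fun s =>
      (hf.hasFDerivAt_integral H he he1 hr s).continuousAt)
  | succ N ih =>
    exact contDiff_succ_iff_hasFDerivAt.2 ⟨_, contDiff_orbitDeriv fun j =>
      ih (hf.mixedD H (.inl j)), fun s => hf.hasFDerivAt_integral H he he1 hr s⟩

open MeasureTheory in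
theorem HasSymbolOrder.δd_integral (H : IsIsometricAction αa) (he : Continuous e)
    (he1 : ∀ x, ‖e x‖ ≤ 1) (hr : (2 * n : ℝ) < r) (hf : HasSymbolOrder αa (-r) f) (j : Fin n) :
    δd αa j (∫ x, e x • f x) = ∫ x, e x • _root_.mixedD αa (.inl j) f x := by
  rw [δd, (hf.hasFDerivAt_integral H he he1 hr 0).fderiv, orbitDeriv_single, H.zero, smul_smul]
  simp

open MeasureTheory in
theorem HasSymbolOrder.norm_δpow_integral_le (H : IsIsometricAction αa) (he : Continuous e)
    (he1 : ∀ x, ‖e x‖ ≤ 1) (hr : (2 * n : ℝ) < r) (hf : HasSymbolOrder αa (-r) f)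
    (c : Fin n → ℕ) {K : ℝ} (hK : DerivBound αa (-r) (mdeg c) K f) :
    ‖δpow αa c (∫ x, e x • f x)‖ ≤ K * ∫ x : R2n n, (1 + ‖x.1‖ + ‖x.2‖) ^ (-r) := by
  have h := compList_semiconj_on (S := {f | HasSymbolOrder αa (-r) f})
    (fun j => _root_.mixedD αa (.inl j)) (δd αa) (fun f : R2n n → A => ∫ x, e x • f x)
    (fun j f hf => HasSymbolOrder.mixedD H hf (.inl j))
    (fun j f hf => (HasSymbolOrder.δd_integral H he he1 hr hf j).symm) c f hf
  have hb := DerivBound.compList (fun j => .inl j) c 0 (by simpa using hK)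
  rw [δpow, ← h, ← integral_const_mul]
  exact norm_integral_le_of_norm_le ((integrable_weight hr).const_mul K)
    (Eventually.of_forall (norm_smul_le_weight he1 hb.norm_le))

/-- The normalized phase `(2π)^{-n} e^{is·ξ}` of the oscillating integral. -/
def oscPhase (x : R2n n) : ℂ :=
  ((((2 * Real.pi) ^ n)⁻¹ : ℝ) : ℂ) * Complex.exp (Complex.I * ((∑ j, x.1 j * x.2 j : ℝ) : ℂ))

theorem continuous_oscPhase : Continuous (oscPhase (n := n)) := by
  unfold oscPhase
  fun_prop

theorem norm_oscPhase_le_one (x : R2n n) : ‖oscPhase x‖ ≤ 1 := by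
  rw [oscPhase, norm_mul, Complex.norm_exp_I_mul_ofReal, mul_one, Complex.norm_real,
    Real.norm_of_nonneg (by positivity)]
  exact inv_le_one_of_one_le₀ (one_le_pow₀ (by linarith [Real.two_le_pi]))

theorem Josc_eq_integral (χc : R2n n → ℝ) (N : ℕ) (f : R2n n → A) :
    Josc χc N f = ∫ x, oscPhase x • (Ltrans χc)^[N] f x := by
  rw [Josc, ← MeasureTheory.integral_smul]
  simp only [oscPhase, mul_smul, Complex.coe_smul]

theorem two_mul_lt_Nfor_sub (n : ℕ) (m : ℝ) : (2 * n : ℝ) < (Nfor n m : ℝ) - m := by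
  have := Nat.le_ceil m
  rw [Nfor]
  push_cast
  linarith

theorem qSemi_nonneg (m : ℝ) (N : ℕ) (f : R2n n → A) : 0 ≤ qSemi αa m N f :=
  Real.iSup_nonneg fun q => mul_nonneg (Real.rpow_nonneg (weight_pos q.2).le _) (norm_nonneg _)

theorem frSemi_nonneg (N : ℕ) (u : A) : 0 ≤ frSemi αa N u :=
  Real.iSup_nonneg fun _ => norm_nonneg _

theorem HasSymbolOrder.iterate_Ltrans (H : IsIsometricAction αa) {χc : R2n n → ℝ}
    (hχ : ContDiff ℝ ∞ χc) (hc : HasCompactSupport χc) (h1 : ∀ᶠ x in 𝓝 (0 : R2n n), χc x = 1)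
    {m : ℝ} (hf : HasSymbolOrder αa m f) (N : ℕ) :
    HasSymbolOrder αa (-(N - m)) ((Ltrans χc)^[N] f) where
  jointSmooth := iterate_mem (S := {f | JointSmooth αa f})
    (fun _ h => JointSmooth.Ltrans H hχ hc h1 h) N f hf.jointSmooth
  bound M := by
    obtain ⟨C, -, hC⟩ := exists_derivBound_iterate_Ltrans H hχ hc h1 N M
    obtain ⟨K, hK⟩ := hf.bound (M + N)
    rw [neg_sub]
    exact ⟨C * K, hC m K f hf.jointSmooth hK⟩

theorem IsAmplitude.hasSymbolOrder_mul_shiftMap (H : IsIsometricAction αa) {m : ℝ} {u : A}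
    (hf : IsAmplitude αa m f) (hu : u ∈ SmoothSet αa) :
    HasSymbolOrder αa m (fun x => f x * αa (-x.1) u) :=
  ⟨hf.jointSmooth_mul_shiftMap H hu, fun N => ⟨_, hf.derivBound_mul_shiftMap H hu N⟩⟩

theorem exists_norm_δpow_Josc_le (H : IsIsometricAction αa) {χc : R2n n → ℝ}
    (hχ : ContDiff ℝ ∞ χc) (hc : HasCompactSupport χc) (h1 : ∀ᶠ x in 𝓝 (0 : R2n n), χc x = 1)
    {m : ℝ} {N : ℕ} (hN : (2 * n : ℝ) < N - m) (c : Fin n → ℕ) :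
    ∃ C : ℝ, 0 ≤ C ∧ ∀ (f : R2n n → A) (K : ℝ), HasSymbolOrder αa m f →
      DerivBound αa m (mdeg c + N) K f → ‖δpow αa c (Josc χc N f)‖ ≤ C * K := by
  obtain ⟨C, hC0, hC⟩ := exists_derivBound_iterate_Ltrans (αa := αa) H hχ hc h1 N (mdeg c)
  refine ⟨C * ∫ x : R2n n, (1 + ‖x.1‖ + ‖x.2‖) ^ (-(N - m)), mul_nonneg hC0
    (MeasureTheory.integral_nonneg fun x => Real.rpow_nonneg (weight_pos x).le _),
    fun f K hf hK => ?_⟩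
  rw [Josc_eq_integral, mul_right_comm]
  refine (hf.iterate_Ltrans H hχ hc h1 N).norm_δpow_integral_le H continuous_oscPhase
    norm_oscPhase_le_one hN c ?_
  rw [neg_sub]
  exact hC m K f hf.jointSmooth hK

theorem Josc_add (H : IsIsometricAction αa) {χc : R2n n → ℝ}
    (hχ : ContDiff ℝ ∞ χc) (hc : HasCompactSupport χc) (h1 : ∀ᶠ x in 𝓝 (0 : R2n n), χc x = 1)
    {m : ℝ} {N : ℕ} (hN : (2 * n : ℝ) < N - m) (hf : HasSymbolOrder αa m f)
    (hg : HasSymbolOrder αa m g) :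
    Josc χc N (fun x => f x + g x) = Josc χc N f + Josc χc N g := by
  simp only [Josc_eq_integral, iterate_Ltrans_add H hχ hc h1 hf.jointSmooth hg.jointSmooth,
    smul_add]
  exact MeasureTheory.integral_add
    ((hf.iterate_Ltrans H hχ hc h1 N).integrable H continuous_oscPhase norm_oscPhase_le_one hN)
    ((hg.iterate_Ltrans H hχ hc h1 N).integrable H continuous_oscPhase norm_oscPhase_le_one hN)

theorem Josc_const_smul (H : IsIsometricAction αa) {χc : R2n n → ℝ}
    (hχ : ContDiff ℝ ∞ χc) (hc : HasCompactSupport χc) (h1 : ∀ᶠ x in 𝓝 (0 : R2n n), χc x = 1)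
    (hf : JointSmooth αa f) (c : ℂ) (N : ℕ) :
    Josc χc N (fun x => c • f x) = c • Josc χc N f := by
  simp only [Josc_eq_integral, iterate_Ltrans_const_smul H hχ hc h1 hf, smul_comm _ c]
  exact MeasureTheory.integral_smul c _

end IsometricAction

/-- (1) for `a ∈ A^m(ℝⁿ×ℝⁿ;𝒜_θ)` and `u ∈ 𝒜_θ`, `(s,ξ) ↦ a(s,ξ)α_{−s}(u)` is
again in `A^m(ℝⁿ×ℝⁿ;𝒜_θ)`, and `(a,u) ↦ a α_{−s}(u)` is continuous bilinear;
(2) consequently `P_a u := J(a(s,ξ)α_{−s}(u))` is well defined, `(a,u) ↦ P_a u` is a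
continuous bilinear map `A^m × 𝒜_θ → 𝒜_θ`, and each `P_a : 𝒜_θ → 𝒜_θ` is a continuous
linear operator. -/
theorem statement_15
    {n : ℕ} (hn : 2 ≤ n)
    {A : Type} [NormedRing A] [StarRing A] [CStarRing A] [NormedAlgebra ℂ A]
    [StarModule ℂ A] [CompleteSpace A]
    (αa : Rn n → (A ≃⋆ₐ[ℂ] A))
    (hαadd : ∀ s t (u : A), αa (s + t) u = αa s (αa t u))
    (hα0 : ∀ u : A, αa 0 u = u)
    (hαiso : ∀ s (u : A), ‖αa s u‖ = ‖u‖)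
    (χc : R2n n → ℝ)
    (hχsm : ∀ N : ℕ, ContDiff ℝ N χc)
    (hχcp : HasCompactSupport χc)
    (hχ1 : ∀ᶠ x in nhds (0 : R2n n), χc x = 1)
    (m : ℝ) :
    -- (1) `(s,ξ) ↦ a(s,ξ) α_{-s}(u)` is an amplitude of order `m` …
    (∀ a : R2n n → A, IsAmplitude αa m a → ∀ u ∈ SmoothSet αa,
      IsAmplitude αa m (fun x : R2n n => a x * αa (-x.1) u)) ∧
    -- … depending continuously (bilinearly) on `(a,u)`
    (∀ N : ℕ, ∃ (C : ℝ) (N₁ N₂ : ℕ), 0 < C ∧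
      ∀ a : R2n n → A, IsAmplitude αa m a → ∀ u ∈ SmoothSet αa,
        qSemi αa m N (fun x : R2n n => a x * αa (-x.1) u) ≤
          C * qSemi αa m N₁ a * frSemi αa N₂ u) ∧
    -- (2) `P_a u = J(a(s,ξ)α_{-s}(u))` maps `𝒜_θ` to `𝒜_θ` …
    (∀ a : R2n n → A, IsAmplitude αa m a → ∀ u ∈ SmoothSet αa,
      Josc χc (Nfor n m) (fun x : R2n n => a x * αa (-x.1) u) ∈ SmoothSet αa) ∧
    -- … is linear in `u` and in `a` …
    (∀ a : R2n n → A, IsAmplitude αa m a →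
      (∀ u ∈ SmoothSet αa, ∀ v ∈ SmoothSet αa,
        Josc χc (Nfor n m) (fun x : R2n n => a x * αa (-x.1) (u + v)) =
          Josc χc (Nfor n m) (fun x : R2n n => a x * αa (-x.1) u) +
            Josc χc (Nfor n m) (fun x : R2n n => a x * αa (-x.1) v)) ∧
      (∀ (c : ℂ), ∀ u ∈ SmoothSet αa,
        Josc χc (Nfor n m) (fun x : R2n n => a x * αa (-x.1) (c • u)) =
          c • Josc χc (Nfor n m) (fun x : R2n n => a x * αa (-x.1) u))) ∧
    -- … and is jointly continuous in `(a,u)` for the natural seminorms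
    (∀ c : Fin n → ℕ, ∃ (C : ℝ) (N₁ N₂ : ℕ), 0 < C ∧
      ∀ a : R2n n → A, IsAmplitude αa m a → ∀ u ∈ SmoothSet αa,
        ‖δpow αa c (Josc χc (Nfor n m) (fun x : R2n n => a x * αa (-x.1) u))‖ ≤
          C * qSemi αa m N₁ a * frSemi αa N₂ u) := by
  have H : IsIsometricAction αa := ⟨hαadd, hα0, hαiso⟩
  have hχ : ContDiff ℝ (⊤ : ℕ∞) χc := contDiff_infty.2 hχsm
  have hN := two_mul_lt_Nfor_sub n m
  have hS := fun (a : R2n n → A) (ha : IsAmplitude αa m a) (u : A) (hu : u ∈ SmoothSet αa) =>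
    ha.hasSymbolOrder_mul_shiftMap H hu
  refine ⟨fun a ha u hu => ha.mul_shiftMap H hu,
    fun N => ⟨2 ^ N, N, N, by positivity, fun a ha u hu => ?_⟩, fun a ha u hu => ?_,
    fun a ha => ⟨fun u hu v hv => ?_, fun c u hu => ?_⟩, fun c => ?_⟩
  · rw [mul_assoc]
    exact (ha.derivBound_mul_shiftMap H hu N).qSemi_le H (hS a ha u hu).jointSmooth
  · rw [Josc_eq_integral]
    exact ((hS a ha u hu).iterate_Ltrans H hχ hχcp hχ1 _).integral_mem H continuous_oscPhase
      norm_oscPhase_le_one hN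
  · simp only [map_add, mul_add]
    exact Josc_add H hχ hχcp hχ1 hN (hS a ha u hu) (hS a ha v hv)
  · simp only [map_smul, mul_smul_comm]
    exact Josc_const_smul H hχ hχcp hχ1 (hS a ha u hu).jointSmooth c _
  · obtain ⟨C, hC0, hC⟩ := exists_norm_δpow_Josc_le H hχ hχcp hχ1 hN c
    set M := mdeg c + Nfor n m
    refine ⟨C * 2 ^ M + 1, M, M, by positivity, fun a ha u hu => ?_⟩
    refine (hC _ _ (hS a ha u hu) (ha.derivBound_mul_shiftMap H hu M)).trans ?_
    have := mul_nonneg (qSemi_nonneg (αa := αa) m M a) (frSemi_nonneg (αa := αa) M u)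
    linarith
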